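/- Let b be a rational function in the closed unit ball of H∞ with ‖b‖∞ = 1 that is not a finite Blaschke product. Let φ ∈ H(b) ∩ ball(H∞) with φ(ξ_j) ∈ Z_T(a) for 1 ≤ j ≤ p and φ(ξ_j) ∈ D for p+1 ≤ j ≤ n; for 1 ≤ k ≤ p let ℓ_k be the index with φ(ξ_k) = ξ_{ℓ_k}. If the composition operator C_φ is bounded on H(b), then m_k ≤ m_{ℓ_k} for every 1 ≤ k ≤ p; moreover, if m_k = m_{ℓ_k} for some 1 ≤ k ≤ p, then φ has an angular derivative in the sense of Carathéodory at ξ_k. -/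

import Mathlib

open Complex MeasureTheory Set Filter

noncomputable section

attribute [local instance] Classical.propDecidable

/-- The open unit disk in `ℂ`. -/
def unitDisk : Set ℂ := Metric.ball 0 1

/-- The unit circle in `ℂ`. -/
def unitCircle : Set ℂ := Metric.sphere 0 1

/-- Membership in `H^∞`: analytic and bounded on the unit disk. -/
def MemHinf (f : ℂ → ℂ) : Prop :=
  DifferentiableOn ℂ f unitDisk ∧ ∃ C : ℝ, ∀ z ∈ unitDisk, ‖f z‖ ≤ C

/-- Membership in the closed unit ball of `H^∞`. -/
def MemBallHinf (f : ℂ → ℂ) : Prop :=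
  DifferentiableOn ℂ f unitDisk ∧ ∀ z ∈ unitDisk, ‖f z‖ ≤ 1

/-- `f` agrees on the closed unit disk with a rational function without poles there. -/
def IsRationalOnDisk (f : ℂ → ℂ) : Prop :=
  ∃ P Q : Polynomial ℂ, ∀ z ∈ Metric.closedBall (0:ℂ) 1,
    Q.eval z ≠ 0 ∧ f z = P.eval z / Q.eval z

/-- `f` is a finite Blaschke product (multiplicities are encoded by repetition). -/
def IsFiniteBlaschke (f : ℂ → ℂ) : Prop :=
  ∃ (γ : ℂ) (k : ℕ) (lam : Fin k → ℂ), ‖γ‖ = 1 ∧ (∀ i, lam i ∈ unitDisk) ∧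
    ∀ z ∈ unitDisk, f z = γ * ∏ i, (z - lam i) / (1 - (starRingEnd ℂ) (lam i) * z)

/-- The `k`-th Taylor coefficient of `f` at the origin. -/
def taylorCoeff (f : ℂ → ℂ) (k : ℕ) : ℂ := iteratedDeriv k f 0 / k.factorial

/-- Membership in the Hardy space `H²` (square-summable Taylor coefficients). -/
def MemH2 (f : ℂ → ℂ) : Prop :=
  DifferentiableOn ℂ f unitDisk ∧ Summable fun k => ‖taylorCoeff f k‖ ^ 2

/-- The squared `H²` norm. -/
def h2NormSq (f : ℂ → ℂ) : ℝ := ∑' k, ‖taylorCoeff f k‖ ^ 2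

/-- The `H²` inner product. -/
def h2Inner (f g : ℂ → ℂ) : ℂ :=
  ∑' k, (starRingEnd ℂ) (taylorCoeff f k) * taylorCoeff g k

/-- The polynomial `a₁(z) = ∏ⱼ (z − ξⱼ)^{mⱼ}`. -/
def a1fun {n : ℕ} (ξ : Fin n → ℂ) (m : Fin n → ℕ) : ℂ → ℂ :=
  fun z => ∏ j, (z - ξ j) ^ (m j)

/-- A decomposition `f = a₁ g + q` with `g ∈ H²`, `deg q ≤ N − 1`, witnessing membership
in `H(b) = a₁H² ⊕ P_{N−1}`. -/
def HbDecompOf {n : ℕ} (ξ : Fin n → ℂ) (m : Fin n → ℕ)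
    (f g : ℂ → ℂ) (q : Polynomial ℂ) : Prop :=
  MemH2 g ∧ q.degree < ((∑ j, m j : ℕ) : WithBot ℕ) ∧
    ∀ z ∈ unitDisk, f z = a1fun ξ m z * g z + q.eval z

/-- Membership in `H(b) = a₁ H² ⊕ P_{N−1}` (description of `H(b)` for `b` rational,
not a finite Blaschke product, whose pythagorean mate has boundary zeros `ξ` with
multiplicities `m`). -/
def MemHb {n : ℕ} (ξ : Fin n → ℂ) (m : Fin n → ℕ) (f : ℂ → ℂ) : Prop :=
  ∃ gq : (ℂ → ℂ) × Polynomial ℂ, HbDecompOf ξ m f gq.1 gq.2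

/-- The (unique) decomposition of a member of `H(b)`. -/
def hbDecomp {n : ℕ} (ξ : Fin n → ℂ) (m : Fin n → ℕ) (f : ℂ → ℂ) :
    (ℂ → ℂ) × Polynomial ℂ :=
  if h : MemHb ξ m f then h.choose else (0, 0)

/-- The squared norm `⦀a₁g + q⦀² = ‖g‖²_{H²} + ‖q‖²_{H²}` on `H(b)`. -/
def hbNormSq {n : ℕ} (ξ : Fin n → ℂ) (m : Fin n → ℕ) (f : ℂ → ℂ) : ℝ :=
  h2NormSq (hbDecomp ξ m f).1 + h2NormSq fun z => ((hbDecomp ξ m f).2).eval z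

/-- The inner product on `H(b)` induced by the decomposition. -/
def hbInner {n : ℕ} (ξ : Fin n → ℂ) (m : Fin n → ℕ) (f g : ℂ → ℂ) : ℂ :=
  h2Inner (hbDecomp ξ m f).1 (hbDecomp ξ m g).1 +
    h2Inner (fun z => ((hbDecomp ξ m f).2).eval z)
      (fun z => ((hbDecomp ξ m g).2).eval z)

/-- The Stolz angle (non-tangential approach region) at a boundary point `ξ`. -/
def stolzAngle (ξ : ℂ) (M : ℝ) : Set ℂ := {z ∈ unitDisk | ‖z - ξ‖ ≤ M * (1 - ‖z‖)}

/-- `f` has non-tangential limit `L` at `ξ`. -/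
def NTLimit (f : ℂ → ℂ) (ξ L : ℂ) : Prop :=
  ∀ M : ℝ, 1 < M → Tendsto f (nhdsWithin ξ (stolzAngle ξ M)) (nhds L)

/-- Radial boundary value of `f` at `ζ` (junk value if the radial limit does not exist). -/
def bdryVal (f : ℂ → ℂ) (ζ : ℂ) : ℂ :=
  limUnder (nhdsWithin (1:ℝ) (Set.Iio 1)) fun r : ℝ => f ((r : ℂ) * ζ)

/-- The full setting: `b` is a rational function in the closed unit ball of `H^∞` with
`‖b‖_∞ = 1` which is not a finite Blaschke product; `a` is its pythagorean mate (rational,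
outer — i.e. zero-free on the disk —, `a(0) > 0`, `|a|² + |b|² = 1` on the circle); the
`ξ j` are the distinct zeros of `a` on the unit circle, with multiplicities `m j`. -/
structure RationalSetting (b a : ℂ → ℂ) (n : ℕ) (ξ : Fin n → ℂ) (m : Fin n → ℕ) :
    Prop where
  b_diff : DifferentiableOn ℂ b unitDisk
  b_rat : IsRationalOnDisk b
  b_le_one : ∀ z ∈ unitDisk, ‖b z‖ ≤ 1
  b_norm_one : sSup ((fun z => ‖b z‖) '' unitDisk) = 1
  b_not_fbp : ¬ IsFiniteBlaschke b
  a_diff : DifferentiableOn ℂ a unitDisk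
  a_rat : IsRationalOnDisk a
  a_outer : ∀ z ∈ unitDisk, a z ≠ 0
  a_zero_pos : 0 < (a 0).re ∧ (a 0).im = 0
  pyth : ∀ ζ ∈ unitCircle, ‖a ζ‖ ^ 2 + ‖b ζ‖ ^ 2 = 1
  zeros_mem : ∀ j, ξ j ∈ unitCircle
  zeros_inj : Function.Injective ξ
  mult_pos : ∀ j, 0 < m j
  factor : ∃ g : ℂ → ℂ, IsRationalOnDisk g ∧ (∀ ζ ∈ unitCircle, g ζ ≠ 0) ∧
    ∀ z ∈ Metric.closedBall (0:ℂ) 1, a z = a1fun ξ m z * g z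

/-- The composition operator `C_φ` maps `H(b)` into itself and is bounded there
(with respect to the equivalent norm `⦀·⦀_b`). -/
def CompBddHb {n : ℕ} (ξ : Fin n → ℂ) (m : Fin n → ℕ) (φ : ℂ → ℂ) : Prop :=
  (∀ f, MemHb ξ m f → MemHb ξ m fun z => f (φ z)) ∧
  ∃ C : ℝ, ∀ f, MemHb ξ m f →
    hbNormSq ξ m (fun z => f (φ z)) ≤ C * hbNormSq ξ m f

/-- The composition operator `C_φ` is compact on `H(b)`: it is bounded and the image of
every sequence in the unit ball has a subsequence whose image converges in `H(b)`. -/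
def CompCompactHb {n : ℕ} (ξ : Fin n → ℂ) (m : Fin n → ℕ) (φ : ℂ → ℂ) : Prop :=
  CompBddHb ξ m φ ∧
  ∀ f : ℕ → ℂ → ℂ, (∀ k, MemHb ξ m (f k) ∧ hbNormSq ξ m (f k) ≤ 1) →
    ∃ (κ : ℕ → ℕ) (g : ℂ → ℂ), StrictMono κ ∧ MemHb ξ m g ∧
      Tendsto (fun i => hbNormSq ξ m fun z => f (κ i) (φ z) - g z) atTop (nhds 0)

/-- The composition operator `C_φ` is Hilbert–Schmidt on `H(b)`: it is bounded and the sum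
of `⦀C_φ e⦀²` over the orthonormal basis `{a₁ z^k}ₖ ∪ {z^j}_{j<N}` of
`(H(b), ⦀·⦀_b)` is finite (the finite part of the sum being automatically finite). -/
def CompHSHb {n : ℕ} (ξ : Fin n → ℂ) (m : Fin n → ℕ) (φ : ℂ → ℂ) : Prop :=
  CompBddHb ξ m φ ∧
  Summable fun k : ℕ => hbNormSq ξ m fun z => a1fun ξ m (φ z) * φ z ^ k

/-- The weighted composition operator `W_{u,φ} f = u · (f ∘ φ)` maps `H²` boundedly
into itself. -/
def WCompBddH2 (u φ : ℂ → ℂ) : Prop :=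
  (∀ f, MemH2 f → MemH2 fun z => u z * f (φ z)) ∧
  ∃ C : ℝ, ∀ f, MemH2 f →
    h2NormSq (fun z => u z * f (φ z)) ≤ C * h2NormSq f

/-- The weighted composition operator `W_{u,φ}` is compact on `H²`. -/
def WCompCompactH2 (u φ : ℂ → ℂ) : Prop :=
  WCompBddH2 u φ ∧
  ∀ f : ℕ → ℂ → ℂ, (∀ k, MemH2 (f k) ∧ h2NormSq (f k) ≤ 1) →
    ∃ (κ : ℕ → ℕ) (g : ℂ → ℂ), StrictMono κ ∧ MemH2 g ∧
      Tendsto (fun i => h2NormSq fun z => u z * f (κ i) (φ z) - g z) atTop (nhds 0)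

/-- The weighted composition operator `W_{u,φ}` is Hilbert–Schmidt on `H²`
(sum over the orthonormal basis `{z^k}` of `H²`). -/
def WCompHSH2 (u φ : ℂ → ℂ) : Prop :=
  WCompBddH2 u φ ∧ Summable fun k : ℕ => h2NormSq fun z => u z * φ z ^ k

/-- The function `u = (a₁ ∘ φ) · ∏_{j ≥ p} (φ − φ(ξⱼ))^{mⱼ} / a₁`, where `Λ j = φ(ξ j)`
are the non-tangential limits of `φ` at the zeros of the mate. -/
def ufun {n : ℕ} (p : ℕ) (ξ : Fin n → ℂ) (m : Fin n → ℕ) (Λ : Fin n → ℂ)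
    (φ : ℂ → ℂ) : ℂ → ℂ :=
  fun z => a1fun ξ m (φ z) *
    (∏ j ∈ Finset.univ.filter fun j : Fin n => p ≤ (j : ℕ), (φ z - Λ j) ^ (m j)) /
      a1fun ξ m z

/-- The reproducing kernel of the de Branges–Rovnyak space `H(c)`:
`k_λ^c(z) = (1 − conj(c(λ)) c(z)) / (1 − conj(λ) z)`, as a function of the parameter `λ`
and the evaluation point `z`. -/
def rkKernel (c : ℂ → ℂ) (lam z : ℂ) : ℂ :=
  (1 - (starRingEnd ℂ) (c lam) * c z) / (1 - (starRingEnd ℂ) lam * z)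

/-- `f` belongs to the reproducing kernel Hilbert space `H(c)` with squared norm at
most `t`: for all finite linear combinations of kernels,
`|⟨f, Σ αᵢ k_{λᵢ}⟩|² ≤ t · ‖Σ αᵢ k_{λᵢ}‖²`. -/
def HbRKBound (c f : ℂ → ℂ) (t : ℝ) : Prop :=
  ∀ (k : ℕ) (lam α : Fin k → ℂ), (∀ i, lam i ∈ unitDisk) →
    ‖∑ i, (starRingEnd ℂ) (α i) * f (lam i)‖ ^ 2 ≤
      t * (∑ i, ∑ j, α i * (starRingEnd ℂ) (α j) * rkKernel c (lam i) (lam j)).re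

/-- Membership in the de Branges–Rovnyak space `H(c)` (general RKHS definition). -/
def MemHbRK (c f : ℂ → ℂ) : Prop := ∃ t : ℝ, HbRKBound c f t

/-- `φ` has an angular derivative in the sense of Carathéodory at `ξ`:
`φ` and `φ'` have non-tangential limits at `ξ` and `|φ(ξ)| = 1`. -/
def HasADC (φ : ℂ → ℂ) (ξ : ℂ) : Prop :=
  ∃ L L' : ℂ, ‖L‖ = 1 ∧ NTLimit φ ξ L ∧ NTLimit (deriv φ) ξ L'

/-- The measure `μ_{u,φ}(E) = ∫_{φ⁻¹(E) ∩ T} |u|² dm` (boundary values on the circle,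
normalized Lebesgue measure). -/
def muMeas (u φ : ℂ → ℂ) (E : Set ℂ) : ENNReal :=
  (ENNReal.ofReal (2 * Real.pi))⁻¹ *
    ∫⁻ θ in Set.Ioc (0:ℝ) (2 * Real.pi),
      (if bdryVal φ (Complex.exp (θ * Complex.I)) ∈ E then
        ENNReal.ofReal (‖bdryVal u (Complex.exp (θ * Complex.I))‖ ^ 2) else 0)

/-- `μ_{u,φ}` is a Carleson measure: `μ(S(ζ,r)) ≤ M r` for all Carleson windows
`S(ζ,r) = {z : |z| ≤ 1, |z − ζ| ≤ r}`, `ζ ∈ T`, `0 < r < 1`. -/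
def IsCarleson (u φ : ℂ → ℂ) : Prop :=
  ∃ M : ℝ, 0 < M ∧ ∀ ζ ∈ unitCircle, ∀ r ∈ Set.Ioo (0:ℝ) 1,
    muMeas u φ (Metric.closedBall ζ r ∩ Metric.closedBall 0 1) ≤ ENNReal.ofReal (M * r)

/-- `μ_{u,φ}` is a vanishing Carleson measure: `sup_{ζ∈T} μ(S(ζ,r))/r → 0` as `r → 0`. -/
def IsVanishingCarleson (u φ : ℂ → ℂ) : Prop :=
  ∀ ε > (0:ℝ), ∃ r₀ ∈ Set.Ioo (0:ℝ) 1, ∀ r ∈ Set.Ioo (0:ℝ) r₀, ∀ ζ ∈ unitCircle,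
    muMeas u φ (Metric.closedBall ζ r ∩ Metric.closedBall 0 1) ≤ ENNReal.ofReal (ε * r)

/-- The reproducing kernel integral
`∫_T (1 − |w|²) |u(ξ)|² / |1 − conj(w) φ(ξ)|² dm(ξ)`. -/
def repKerInt (u φ : ℂ → ℂ) (w : ℂ) : ENNReal :=
  (ENNReal.ofReal (2 * Real.pi))⁻¹ *
    ∫⁻ θ in Set.Ioc (0:ℝ) (2 * Real.pi),
      ENNReal.ofReal ((1 - ‖w‖ ^ 2) * ‖bdryVal u (Complex.exp (θ * Complex.I))‖ ^ 2 /
        ‖1 - (starRingEnd ℂ) w * bdryVal φ (Complex.exp (θ * Complex.I))‖ ^ 2)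

theorem mem_unitDisk_iff {z : ℂ} : z ∈ unitDisk ↔ ‖z‖ < 1 := by simp [unitDisk]

theorem isOpen_unitDisk : IsOpen unitDisk := Metric.isOpen_ball

theorem normsq_id1 (z w : ℂ) : ‖1 - (starRingEnd ℂ) w * z‖ ^ 2 =
    ‖z - w‖ ^ 2 + (1 - ‖z‖ ^ 2) * (1 - ‖w‖ ^ 2) := by
  simp only [← Complex.normSq_eq_norm_sq, Complex.normSq_apply]
  simp; ring

theorem normsq_id2 (z w : ℂ) : ‖z + (starRingEnd ℂ) w‖ ^ 2 =
    ‖z - w‖ ^ 2 + 4 * z.re * w.re := by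
  simp only [← Complex.normSq_eq_norm_sq, Complex.normSq_apply]
  simp; ring

theorem one_sub_conj_mul_ne {z w : ℂ} (hz : ‖z‖ < 1) (hw : ‖w‖ < 1) :
    1 - (starRingEnd ℂ) w * z ≠ 0 := by
  intro h
  have h1 : (starRingEnd ℂ) w * z = 1 := by linear_combination -h
  have h2 : ‖w‖ * ‖z‖ = 1 := by simpa using congrArg norm h1
  nlinarith [norm_nonneg z, norm_nonneg w]

/-- Schwarz–Pick for functions with positive real part. -/
theorem schwarz_pick_re {f : ℂ → ℂ} (hf : DifferentiableOn ℂ f unitDisk)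
    (hre : ∀ z ∈ unitDisk, 0 < (f z).re) {z z₀ : ℂ} (hz : z ∈ unitDisk) (hz₀ : z₀ ∈ unitDisk) :
    ‖f z - f z₀‖ ^ 2 * ((1 - ‖z‖ ^ 2) * (1 - ‖z₀‖ ^ 2)) ≤
      4 * (f z).re * (f z₀).re * ‖z - z₀‖ ^ 2 := by
  rw [mem_unitDisk_iff] at hz hz₀
  have hden : ∀ ζ : ℂ, ‖ζ‖ < 1 → 1 + (starRingEnd ℂ) z₀ * ζ ≠ 0 := by
    intro ζ hζ
    have := one_sub_conj_mul_ne (z := -ζ) (w := z₀) (by simpa using hζ) hz₀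
    simpa using this
  set T : ℂ → ℂ := fun ζ => (ζ + z₀) / (1 + (starRingEnd ℂ) z₀ * ζ) with hT
  have hTmap : ∀ ζ : ℂ, ‖ζ‖ < 1 → ‖T ζ‖ < 1 := by
    intro ζ hζ
    have h1 := normsq_id1 (-ζ) z₀
    have h2 : ‖-ζ - z₀‖ = ‖ζ + z₀‖ := by rw [← norm_neg]; congr 1; ring
    have h3 : 1 - (starRingEnd ℂ) z₀ * -ζ = 1 + (starRingEnd ℂ) z₀ * ζ := by ring
    rw [h2, h3, norm_neg] at h1
    have h4 := norm_pos_iff.2 (hden ζ hζ)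
    simp only [hT]
    rw [norm_div, div_lt_one h4]
    have h5 : 0 < (1 - ‖ζ‖ ^ 2) * (1 - ‖z₀‖ ^ 2) := by
      apply mul_pos <;> nlinarith [norm_nonneg ζ, norm_nonneg z₀]
    apply lt_of_pow_lt_pow_left₀ 2 h4.le
    linarith
  have hden2 : ∀ w ∈ unitDisk, f w + (starRingEnd ℂ) (f z₀) ≠ 0 := by
    intro w hw h
    have := congrArg Complex.re h
    simp at this
    linarith [hre w hw, hre z₀ (mem_unitDisk_iff.2 hz₀)]
  set g : ℂ → ℂ := fun ζ => (f (T ζ) - f z₀) / (f (T ζ) + (starRingEnd ℂ) (f z₀)) with hg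
  have hTd : DifferentiableOn ℂ T (Metric.ball 0 1) := by
    intro ζ hζ
    apply DifferentiableAt.differentiableWithinAt
    have := hden ζ (by simpa using hζ)
    simp only [hT]
    fun_prop (disch := assumption)
  have hfT : DifferentiableOn ℂ (fun ζ => f (T ζ)) (Metric.ball 0 1) :=
    hf.comp hTd (fun ζ hζ => mem_unitDisk_iff.2 (hTmap ζ (by simpa using hζ)))
  have hgd : DifferentiableOn ℂ g (Metric.ball 0 1) :=
    (hfT.sub_const _).div (hfT.add_const _)
      (fun ζ hζ => hden2 _ (mem_unitDisk_iff.2 (hTmap ζ (by simpa using hζ))))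
  have hg0 : g 0 = 0 := by simp [hg, hT]
  have hgm : MapsTo g (Metric.ball 0 1) (Metric.closedBall 0 1) := by
    intro ζ hζ
    have hm : T ζ ∈ unitDisk := mem_unitDisk_iff.2 (hTmap ζ (by simpa using hζ))
    simp only [mem_closedBall_zero_iff, hg]
    rw [norm_div, div_le_one (norm_pos_iff.2 (hden2 _ hm))]
    apply le_of_sq_le_sq _ (norm_nonneg _)
    rw [normsq_id2]
    have := mul_pos (hre _ hm) (hre _ (mem_unitDisk_iff.2 hz₀))
    nlinarith
  have hd0 := one_sub_conj_mul_ne hz hz₀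
  set ζ : ℂ := (z - z₀) / (1 - (starRingEnd ℂ) z₀ * z) with hζ
  have hid := normsq_id1 z z₀
  have hpos : 0 < (1 - ‖z‖ ^ 2) * (1 - ‖z₀‖ ^ 2) := by
    apply mul_pos <;> nlinarith [norm_nonneg z, norm_nonneg z₀]
  have hζ1 : ‖ζ‖ < 1 := by
    rw [hζ, norm_div, div_lt_one (norm_pos_iff.2 hd0)]
    apply lt_of_pow_lt_pow_left₀ 2 (norm_nonneg _)
    linarith
  have hTζ : T ζ = z := by
    have h1 := hden ζ hζ1
    simp only [hT]
    rw [div_eq_iff h1]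
    have h2 : ζ * (1 - (starRingEnd ℂ) z₀ * z) = z - z₀ := by rw [hζ, div_mul_cancel₀ _ hd0]
    linear_combination h2
  have hs := Complex.norm_le_norm_of_mapsTo_ball hgd hgm hg0 hζ1
  simp only [hg, hTζ] at hs
  rw [hζ, norm_div, norm_div, div_le_div_iff₀ (norm_pos_iff.2 (hden2 _ (mem_unitDisk_iff.2 hz)))
    (norm_pos_iff.2 hd0)] at hs
  have hs2 := pow_le_pow_left₀ (by positivity) hs 2
  rw [mul_pow, mul_pow, hid, normsq_id2] at hs2
  nlinarith

theorem one_sub_norm_lower {φ : ℂ → ℂ} (hd : DifferentiableOn ℂ φ unitDisk)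
    (hmap : ∀ z ∈ unitDisk, φ z ∈ unitDisk) :
    ∃ c > 0, ∀ z ∈ unitDisk, c * (1 - ‖z‖) ≤ 1 - ‖φ z‖ := by
  have h0 : (0:ℂ) ∈ unitDisk := by simp [unitDisk]
  have hφ0 := mem_unitDisk_iff.1 (hmap 0 h0)
  refine ⟨(1 - ‖φ 0‖) / 16, by linarith, fun z hz => ?_⟩
  have hφz := mem_unitDisk_iff.1 (hmap z hz)
  have hz1 := mem_unitDisk_iff.1 hz
  obtain ⟨u, hu1, hu⟩ : ∃ u : ℂ, ‖u‖ = 1 ∧ u * φ z = (‖φ z‖ : ℂ) := by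
    by_cases h : φ z = 0
    · exact ⟨1, by simp, by simp [h]⟩
    · refine ⟨(‖φ z‖ : ℂ) / φ z, ?_, by field_simp⟩
      rw [norm_div]; simp [h]
  have hre : ∀ w ∈ unitDisk, 1 - ‖φ w‖ ≤ (1 - u * φ w).re := by
    intro w hw
    have := Complex.re_le_norm (u * φ w)
    rw [norm_mul, hu1, one_mul] at this
    simp only [Complex.sub_re, Complex.one_re]; linarith
  have key := schwarz_pick_re (f := fun w => 1 - u * φ w)
    ((hd.const_mul u).const_sub 1)
    (fun w hw => by have := hre w hw; have := mem_unitDisk_iff.1 (hmap w hw); linarith) hz h0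
  have e1 : (1 - u * φ z).re = 1 - ‖φ z‖ := by rw [hu]; simp
  have e2 : 1 - u * φ z = ((1 - ‖φ z‖ : ℝ) : ℂ) := by rw [hu]; simp
  have hG0 := hre 0 h0
  set d := 1 - ‖φ z‖ with hdd
  set R := (1 - u * φ 0).re with hR
  simp only [e1, norm_zero, sub_zero] at key
  by_contra! hcon
  have hn : R - d ≤ ‖(1 - u * φ z) - (1 - u * φ 0)‖ := by
    have := Complex.abs_re_le_norm ((1 - u * φ z) - (1 - u * φ 0))
    rw [Complex.sub_re, e1] at this
    linarith [neg_abs_le (d - R)]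
  have hzn := norm_nonneg z
  have hdR : d ≤ R / 2 := by nlinarith
  have hRpos : 0 < R := by linarith
  have h1 : (R / 2) ^ 2 ≤ ‖(1 - u * φ z) - (1 - u * φ 0)‖ ^ 2 := by
    apply pow_le_pow_left₀ (by positivity); linarith
  have hz2 : ‖z‖ ^ 2 ≤ 1 := by nlinarith
  have hdpos : 0 < d := by linarith
  have h2 : (R/2)^2 * (1 - ‖z‖ ^ 2) ≤ 4 * d * R := by
    calc (R/2)^2 * (1 - ‖z‖ ^ 2) ≤ ‖(1 - u * φ z) - (1 - u * φ 0)‖ ^ 2 * (1 - ‖z‖ ^ 2) := by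
          gcongr
      _ ≤ 4 * d * R * ‖z‖ ^ 2 := by simpa using key
      _ ≤ 4 * d * R * 1 := by gcongr
      _ = 4 * d * R := by ring
  have h3 : R * (1 - ‖z‖ ^ 2) ≤ 16 * d := by
    have : R * (R * (1 - ‖z‖ ^ 2)) ≤ R * (16 * d) := by nlinarith
    exact le_of_mul_le_mul_left this hRpos
  nlinarith

theorem ntlimit_deriv_of_slope {φ : ℂ → ℂ} {ξ η d : ℂ} (hd : DifferentiableOn ℂ φ unitDisk)
    (hξ : ‖ξ‖ = 1)
    (h : ∀ M : ℝ, 1 < M → Tendsto (fun z => (η - φ z) / (ξ - z))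
      (nhdsWithin ξ (stolzAngle ξ M)) (nhds d)) : NTLimit (deriv φ) ξ d := by
  intro M hM
  rw [Metric.tendsto_nhdsWithin_nhds]
  intro ε hε
  have hM' : 1 < 2 * M + 1 := by linarith
  obtain ⟨δ, hδ, H⟩ := Metric.tendsto_nhdsWithin_nhds.1 (h (2 * M + 1) hM') (ε / (2 * (2 * M + 1)))
    (by positivity)
  refine ⟨δ / 2, by positivity, fun z hz hzδ => ?_⟩
  obtain ⟨hzD, hzS⟩ := hz
  have hz1 := mem_unitDisk_iff.1 hzD
  set ρ := (1 - ‖z‖) / 2 with hρ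
  have hρpos : 0 < ρ := by rw [hρ]; linarith
  have hlow : 1 - ‖z‖ ≤ ‖z - ξ‖ := by
    have := norm_sub_norm_le ξ z
    rw [hξ, norm_sub_rev] at this; exact this
  set ψ : ℂ → ℂ := fun w => φ w - η - d * (w - ξ) with hψ
  have hsub : ∀ w ∈ Metric.closedBall z ρ, w ∈ unitDisk ∧ ρ ≤ 1 - ‖w‖ ∧ ‖w - z‖ ≤ ρ := by
    intro w hw
    rw [mem_closedBall_iff_norm] at hw
    have : ‖w‖ ≤ ‖z‖ + ‖w - z‖ := by
      have := norm_add_le z (w - z); simpa using this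
    refine ⟨mem_unitDisk_iff.2 ?_, ?_, hw⟩ <;> rw [hρ] at * <;> linarith
  have hψd : DifferentiableOn ℂ ψ unitDisk := by
    apply (hd.sub_const η).sub
    fun_prop
  have hbound : ∀ w ∈ Metric.sphere z ρ, ‖ψ w‖ ≤ (ε / 2) * ρ := by
    intro w hw
    obtain ⟨hwD, hw1, hw2⟩ := hsub w (Metric.sphere_subset_closedBall hw)
    have hwξ : ‖w - ξ‖ ≤ ‖z - ξ‖ + ρ := by
      have := norm_add_le (w - z) (z - ξ); simp at this; linarith
    have hwξ' : ‖w - ξ‖ ≤ (2 * M + 1) * ρ := by rw [hρ] at *; linarith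
    have hwS : w ∈ stolzAngle ξ (2 * M + 1) := by
      refine ⟨hwD, hwξ'.trans ?_⟩
      gcongr
    have hne : ξ - w ≠ 0 := by
      intro h0
      have : ξ = w := by linear_combination h0
      have := mem_unitDisk_iff.1 hwD
      rw [← ‹ξ = w›] at this; linarith
    have h2 := H hwS (by
      rw [dist_eq_norm] at hzδ ⊢
      rw [hρ] at *; linarith)
    rw [dist_eq_norm] at h2
    have e : ψ w = -((η - φ w) / (ξ - w) - d) * (ξ - w) := by
      simp only [hψ]; field_simp; ring
    rw [e, norm_mul, norm_neg, norm_sub_rev ξ w]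
    calc _ ≤ (ε / (2 * (2 * M + 1))) * ((2 * M + 1) * ρ) := by gcongr
      _ = (ε / 2) * ρ := by field_simp
  have hder := Complex.norm_deriv_le_of_forall_mem_sphere_norm_le hρpos
    (f := ψ) (c := z) (C := (ε / 2) * ρ) (by
      apply DifferentiableOn.diffContOnCl
      rw [closure_ball _ hρpos.ne']
      exact hψd.mono fun w hw => (hsub w hw).1) hbound
  have hda : DifferentiableAt ℂ φ z := hd.differentiableAt (isOpen_unitDisk.mem_nhds hzD)
  have hdψ : deriv ψ z = deriv φ z - d := by
    have h1 : HasDerivAt ψ (deriv φ z - d * 1) z :=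
      (hda.hasDerivAt.sub_const η).sub (((hasDerivAt_id z).sub_const ξ).const_mul d)
    simpa using h1.deriv
  rw [dist_eq_norm, ← hdψ]
  calc _ ≤ (ε / 2) * ρ / ρ := hder
    _ = ε / 2 := by field_simp
    _ < ε := by linarith

theorem re_cayley {ξ z : ℂ} (hξ : ‖ξ‖ = 1) (hz : ‖z‖ < 1) :
    ((ξ + z) / (ξ - z)).re = (1 - ‖z‖ ^ 2) / ‖ξ - z‖ ^ 2 := by
  rw [Complex.div_re, ← add_div, Complex.normSq_eq_norm_sq]
  congr 1
  have h1 : ξ.re * ξ.re + ξ.im * ξ.im = 1 := by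
    rw [← Complex.normSq_apply, Complex.normSq_eq_norm_sq, hξ]; norm_num
  rw [← Complex.normSq_eq_norm_sq, Complex.normSq_apply]
  simp
  linear_combination h1

theorem sub_ne_of_circle {ξ z : ℂ} (hξ : ‖ξ‖ = 1) (hz : ‖z‖ < 1) : ξ - z ≠ 0 := by
  intro h
  have : ξ = z := by linear_combination h
  rw [this] at hξ; linarith

theorem re_cayley_pos {ξ z : ℂ} (hξ : ‖ξ‖ = 1) (hz : ‖z‖ < 1) :
    0 < ((ξ + z) / (ξ - z)).re := by
  rw [re_cayley hξ hz]
  have := norm_pos_iff.2 (sub_ne_of_circle hξ hz)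
  have : 0 < 1 - ‖z‖ ^ 2 := by nlinarith [norm_nonneg z]
  positivity

/-- Nontangential limit of `(ξ - z) F z` for `F` with positive real part. -/
theorem nt_limit_pos_re {F : ℂ → ℂ} {ξ : ℂ} (hξ : ‖ξ‖ = 1) (hF : DifferentiableOn ℂ F unitDisk)
    (hre : ∀ z ∈ unitDisk, 0 < (F z).re) :
    ∃ c : ℝ, ∀ M : ℝ, 1 < M → Tendsto (fun z => (ξ - z) * F z)
      (nhdsWithin ξ (stolzAngle ξ M)) (nhds (c * (ξ + ξ))) := by
  set P : ℂ → ℂ := fun z => (ξ + z) / (ξ - z) with hP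
  have hPre : ∀ z ∈ unitDisk, 0 < (P z).re := fun z hz =>
    re_cayley_pos hξ (mem_unitDisk_iff.1 hz)
  have hPd : DifferentiableOn ℂ P unitDisk := by
    intro z hz
    have := sub_ne_of_circle hξ (mem_unitDisk_iff.1 hz)
    apply DifferentiableAt.differentiableWithinAt
    simp only [hP]
    fun_prop (disch := assumption)
  set S : Set ℝ := (fun z => (F z).re / (P z).re) '' unitDisk with hS
  have hSb : BddBelow S := ⟨0, by
    rintro _ ⟨z, hz, rfl⟩
    exact (div_pos (hre z hz) (hPre z hz)).le⟩
  have hSne : S.Nonempty := ⟨_, 0, by simp [unitDisk], rfl⟩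
  set c := sInf S with hc
  refine ⟨c, fun M hM => ?_⟩
  have hmain : ∀ ε > 0, ∀ᶠ z in nhdsWithin ξ (stolzAngle ξ M),
      ‖(ξ - z) * F z - c * (ξ + z)‖ ≤ (64 * M + 4) * ε := by
    intro ε hε
    obtain ⟨_, ⟨z₀, hz₀, rfl⟩, hlt⟩ := exists_lt_of_csInf_lt hSne (show sInf S < c + ε by linarith)
    set G : ℂ → ℂ := fun z => F z - ((c - ε : ℝ) : ℂ) * P z with hG
    have hGre : ∀ z, (G z).re = (F z).re - (c - ε) * (P z).re := by
      intro z; simp only [hG, Complex.sub_re, Complex.re_ofReal_mul]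
    have hGpos : ∀ z ∈ unitDisk, 0 < (G z).re := by
      intro z hz
      have h1 : c ≤ (F z).re / (P z).re := csInf_le hSb ⟨z, hz, rfl⟩
      rw [le_div_iff₀ (hPre z hz)] at h1
      rw [hGre]; nlinarith [hPre z hz]
    have hG0 : (G z₀).re ≤ 2 * ε * (P z₀).re := by
      simp only at hlt
      rw [div_lt_iff₀ (hPre z₀ hz₀)] at hlt
      rw [hGre]; linarith
    have hGd : DifferentiableOn ℂ G unitDisk := hF.sub (hPd.const_mul _)
    have hz₀' := mem_unitDisk_iff.1 hz₀
    have ht0 := norm_pos_iff.2 (sub_ne_of_circle hξ hz₀')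
    have ev1 : ∀ᶠ z in nhds ξ, ‖z - z₀‖ ^ 2 < 2 * ‖ξ - z₀‖ ^ 2 := by
      apply ContinuousAt.eventually_lt (by fun_prop) (by fun_prop)
      nlinarith [pow_pos ht0 2]
    have ev2 : ∀ᶠ z in nhds ξ, ‖ξ - z‖ * ‖G z₀‖ < ε := by
      apply ContinuousAt.eventually_lt (by fun_prop) (by fun_prop)
      simpa using hε
    filter_upwards [nhdsWithin_le_nhds ev1, nhdsWithin_le_nhds ev2, self_mem_nhdsWithin]
      with z h1 h2 hz
    obtain ⟨hzD, hzS⟩ := hz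
    have hz1 := mem_unitDisk_iff.1 hzD
    have hne := sub_ne_of_circle hξ hz1
    have hsp := schwarz_pick_re hGd hGpos hzD hz₀
    set t := ‖ξ - z‖ with ht
    have htpos : 0 < t := norm_pos_iff.2 hne
    rw [norm_sub_rev, ← ht] at hzS
    set x := t * ‖G z‖ with hx
    have hx0 : 0 ≤ x := by positivity
    have hq0 : 0 < 1 - ‖z₀‖ ^ 2 := by nlinarith [norm_nonneg z₀]
    -- simplify the Schwarz–Pick bound
    have hA : ‖G z - G z₀‖ ^ 2 * (1 - ‖z‖ ^ 2) ≤ 16 * ε * ‖G z‖ := by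
      have hg1 : (G z₀).re * ‖ξ - z₀‖ ^ 2 ≤ 2 * ε * (1 - ‖z₀‖ ^ 2) := by
        have : (P z₀).re * ‖ξ - z₀‖ ^ 2 = 1 - ‖z₀‖ ^ 2 := by
          simp only [hP]
          rw [re_cayley hξ hz₀', div_mul_cancel₀ _ (by positivity)]
        rw [← this]
        nlinarith [pow_pos ht0 2]
      have hg2 : (G z).re ≤ ‖G z‖ := Complex.re_le_norm _
      have hgp := hGpos z hzD
      have hgp0 := hGpos z₀ hz₀
      have : ‖G z - G z₀‖ ^ 2 * (1 - ‖z‖ ^ 2) * (1 - ‖z₀‖ ^ 2)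
          ≤ 16 * ε * ‖G z‖ * (1 - ‖z₀‖ ^ 2) := by
        calc ‖G z - G z₀‖ ^ 2 * (1 - ‖z‖ ^ 2) * (1 - ‖z₀‖ ^ 2)
            ≤ 4 * (G z).re * (G z₀).re * ‖z - z₀‖ ^ 2 := by rw [mul_assoc]; exact hsp
          _ ≤ 4 * ‖G z‖ * (G z₀).re * (2 * ‖ξ - z₀‖ ^ 2) := by gcongr
          _ = 8 * ‖G z‖ * ((G z₀).re * ‖ξ - z₀‖ ^ 2) := by ring
          _ ≤ 8 * ‖G z‖ * (2 * ε * (1 - ‖z₀‖ ^ 2)) := by gcongr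
          _ = _ := by ring
      exact le_of_mul_le_mul_right this hq0
    have hB : ‖G z - G z₀‖ ^ 2 * t ^ 2 ≤ 16 * ε * M * x := by
      have h3 : t ≤ M * (1 - ‖z‖ ^ 2) := by nlinarith [norm_nonneg z, mul_nonneg (norm_nonneg z) (sub_nonneg.2 hz1.le)]
      calc ‖G z - G z₀‖ ^ 2 * t ^ 2 = ‖G z - G z₀‖ ^ 2 * t * t := by ring
        _ ≤ ‖G z - G z₀‖ ^ 2 * (M * (1 - ‖z‖ ^ 2)) * t := by gcongr
        _ = (‖G z - G z₀‖ ^ 2 * (1 - ‖z‖ ^ 2)) * (M * t) := by ring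
        _ ≤ (16 * ε * ‖G z‖) * (M * t) := by gcongr
        _ = _ := by rw [hx]; ring
    have hC : x - ε ≤ ‖G z - G z₀‖ * t := by
      have := norm_sub_norm_le (G z) (G z₀)
      have h4 := mul_le_mul_of_nonneg_right this htpos.le
      rw [hx]; nlinarith
    have hxb : x ≤ 64 * M * ε + 2 * ε := by
      by_contra! hcon
      have hMe : 0 < M * ε := by positivity
      have h5 : x / 2 ≤ ‖G z - G z₀‖ * t := by nlinarith
      have h6 := pow_le_pow_left₀ (by positivity) h5 2
      nlinarith
    have e : (ξ - z) * F z - c * (ξ + z) = (ξ - z) * G z - ε * (ξ + z) := by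
      simp only [hG, hP]
      field_simp
      push_cast
      ring
    rw [e]
    calc ‖(ξ - z) * G z - ε * (ξ + z)‖ ≤ ‖(ξ - z) * G z‖ + ‖(ε : ℂ) * (ξ + z)‖ := norm_sub_le _ _
      _ = x + ε * ‖ξ + z‖ := by
          rw [norm_mul, norm_mul, ← ht, Complex.norm_real, Real.norm_of_nonneg hε.le]
      _ ≤ x + ε * 2 := by
          have := norm_add_le ξ z
          gcongr; linarith
      _ ≤ _ := by nlinarith
  have hlim0 : Tendsto (fun z => (ξ - z) * F z - c * (ξ + z))
      (nhdsWithin ξ (stolzAngle ξ M)) (nhds 0) := by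
    rw [Metric.tendsto_nhds]
    intro ε hε
    have hK : 0 < 64 * M + 4 := by linarith
    filter_upwards [hmain (ε / (2 * (64 * M + 4))) (by positivity)] with z hz
    rw [dist_zero_right]
    refine hz.trans_lt ?_
    have : (64 * M + 4) * (ε / (2 * (64 * M + 4))) = ε / 2 := by field_simp
    rw [this]; linarith
  have hlim1 : Tendsto (fun z : ℂ => (c : ℂ) * (ξ + z)) (nhdsWithin ξ (stolzAngle ξ M))
      (nhds (c * (ξ + ξ))) := by
    have : ContinuousAt (fun z : ℂ => (c : ℂ) * (ξ + z)) ξ := by fun_prop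
    exact this.tendsto.mono_left nhdsWithin_le_nhds
  simpa using hlim0.add hlim1

theorem radial_tendsto {ξ : ℂ} (hξ : ‖ξ‖ = 1) {M : ℝ} (hM : 1 < M) :
    Tendsto (fun r : ℝ => (r : ℂ) * ξ) (nhdsWithin 1 (Iio 1))
      (nhdsWithin ξ (stolzAngle ξ M)) := by
  rw [tendsto_nhdsWithin_iff]
  constructor
  · have : ContinuousAt (fun r : ℝ => (r : ℂ) * ξ) 1 := by fun_prop
    have h := this.tendsto.mono_left (nhdsWithin_le_nhds (s := Iio 1))
    simpa using h
  · filter_upwards [Ioo_mem_nhdsLT (show (0:ℝ) < 1 by norm_num)] with r hr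
    have h1 : ‖(r : ℂ) * ξ‖ = r := by
      rw [norm_mul, hξ, Complex.norm_real, Real.norm_of_nonneg hr.1.le, mul_one]
    refine ⟨mem_unitDisk_iff.2 (by rw [h1]; exact hr.2), ?_⟩
    have h2 : (r : ℂ) * ξ - ξ = -(((1 - r : ℝ) : ℂ) * ξ) := by push_cast; ring
    rw [h1, h2, norm_neg, norm_mul, hξ, Complex.norm_real, Real.norm_of_nonneg (by linarith [hr.2])]
    nlinarith [hr.2]

/-- A version of the Julia–Carathéodory theorem. -/
theorem hasADC_of_radial {φ : ℂ → ℂ} {ξ η : ℂ} (hd : DifferentiableOn ℂ φ unitDisk)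
    (hmap : ∀ z ∈ unitDisk, φ z ∈ unitDisk) (hξ : ‖ξ‖ = 1) (hη : ‖η‖ = 1)
    (hlim : NTLimit φ ξ η)
    (hC : ∃ C : ℝ, ∀ᶠ r : ℝ in nhdsWithin 1 (Iio 1), ‖φ (r * ξ) - η‖ ≤ C * (1 - r)) :
    HasADC φ ξ := by
  obtain ⟨C, hC⟩ := hC
  have hne : ∀ z ∈ unitDisk, η - φ z ≠ 0 := fun z hz =>
    sub_ne_of_circle hη (mem_unitDisk_iff.1 (hmap z hz))
  obtain ⟨c, hc⟩ := nt_limit_pos_re (F := fun z => (η + φ z) / (η - φ z)) hξ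
    ((hd.const_add η).div (hd.const_sub η) hne)
    (fun z hz => re_cayley_pos hη (mem_unitDisk_iff.1 (hmap z hz)))
  have hη0 : η ≠ 0 := by intro h; simp [h] at hη
  have hξ0 : ξ ≠ 0 := by intro h; simp [h] at hξ
  have hc0 : (c : ℂ) * (ξ + ξ) ≠ 0 := by
    intro h0
    have hM : (1:ℝ) < 2 := by norm_num
    have h1 := (hc 2 hM).comp (radial_tendsto hξ hM)
    rw [h0] at h1
    have h2 := (hlim 2 hM).comp (radial_tendsto hξ hM)
    have h3 : Tendsto (fun r : ℝ => ‖η + φ (r * ξ)‖) (nhdsWithin 1 (Iio 1)) (nhds ‖η + η‖) :=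
      (h2.const_add η).norm
    have h4 : ‖η + η‖ = 2 := by rw [← two_mul, norm_mul, hη]; simp
    rw [h4] at h3
    have h5 := h3.eventually_const_lt (show (1:ℝ) < 2 by norm_num)
    have h6 : Tendsto (fun r : ℝ => (|C| + 1) * ‖(ξ - r * ξ) * ((η + φ (r * ξ)) / (η - φ (r * ξ)))‖)
        (nhdsWithin 1 (Iio 1)) (nhds 0) := by
      have := h1.norm.const_mul (|C| + 1)
      simpa using this
    have h7 := h6.eventually_lt_const (show (0:ℝ) < 1 by norm_num)
    obtain ⟨r, hr5, hr7, hrC, hr⟩ := (h5.and (h7.and (hC.and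
      (Ioo_mem_nhdsLT (show (0:ℝ) < 1 by norm_num))))).exists
    have hrD : (r : ℂ) * ξ ∈ unitDisk := by
      rw [mem_unitDisk_iff, norm_mul, hξ, Complex.norm_real, Real.norm_of_nonneg hr.1.le]
      linarith [hr.2]
    have e1 : ‖ξ - r * ξ‖ = 1 - r := by
      have h2 : ξ - (r : ℂ) * ξ = (((1 - r : ℝ) : ℂ) * ξ) := by push_cast; ring
      rw [h2, norm_mul, hξ, Complex.norm_real, Real.norm_of_nonneg (by linarith [hr.2]), mul_one]
    have hpos := norm_pos_iff.2 (hne _ hrD)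
    rw [norm_mul, norm_div, e1, ← mul_assoc, ← mul_div_assoc, div_lt_one hpos] at hr7
    rw [norm_sub_rev] at hrC
    have h1r : 0 < 1 - r := by linarith [hr.2]
    have : C * (1 - r) ≤ |C| * (1 - r) := by gcongr; exact le_abs_self C
    have : (|C| + 1) * (1 - r) * 1 ≤ (|C| + 1) * (1 - r) * ‖η + φ (r * ξ)‖ := by
      gcongr
    nlinarith
  refine ⟨η, (η + η) / (c * (ξ + ξ)), hη, hlim, ?_⟩
  apply ntlimit_deriv_of_slope (η := η) hd hξ
  intro M hM
  have h1 := ((hlim M hM).const_add η).div (hc M hM) hc0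
  refine h1.congr' ?_
  have hev : ∀ᶠ z in nhdsWithin ξ (stolzAngle ξ M), η + φ z ≠ 0 := by
    have h2 := (hlim M hM).const_add η
    exact h2.eventually_ne (by rw [← two_mul]; exact mul_ne_zero two_ne_zero hη0)
  filter_upwards [self_mem_nhdsWithin, hev] with z hz hz2
  have hz1 := hne z hz.1
  have hz3 := sub_ne_of_circle hξ (mem_unitDisk_iff.1 hz.1)
  simp only [Pi.div_apply]
  field_simp

theorem taylor_hasSum {f : ℂ → ℂ} (hf : DifferentiableOn ℂ f unitDisk) {z : ℂ} (hz : z ∈ unitDisk) :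
    HasSum (fun k => taylorCoeff f k * z ^ k) (f z) := by
  have h := Complex.hasSum_taylorSeries_on_ball (r := 1) (c := 0) (f := f)
    (by simpa [unitDisk] using hf) (by simpa [unitDisk] using hz)
  refine h.congr_fun ?_
  intro k
  simp [taylorCoeff, div_eq_mul_inv]; ring

theorem h2_growth {g : ℂ → ℂ} (hg : MemH2 g) {z : ℂ} (hz : z ∈ unitDisk) :
    ‖g z‖ ^ 2 * (1 - ‖z‖ ^ 2) ≤ h2NormSq g := by
  have hz1 := mem_unitDisk_iff.1 hz
  have hq : ‖z‖ ^ 2 < 1 := by nlinarith [norm_nonneg z]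
  have hpos : 0 < 1 - ‖z‖ ^ 2 := by linarith
  rw [← le_div_iff₀ hpos]
  have ht : Tendsto (fun s : Finset ℕ => ‖∑ k ∈ s, taylorCoeff g k * z ^ k‖ ^ 2) atTop
      (nhds (‖g z‖ ^ 2)) := (Filter.Tendsto.norm (taylor_hasSum hg.1 hz)).pow 2
  refine le_of_tendsto ht (Eventually.of_forall fun s => ?_)
  calc ‖∑ k ∈ s, taylorCoeff g k * z ^ k‖ ^ 2
      ≤ (∑ k ∈ s, ‖taylorCoeff g k‖ * ‖z‖ ^ k) ^ 2 := by
        gcongr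
        refine (norm_sum_le _ _).trans (le_of_eq ?_)
        simp
    _ ≤ (∑ k ∈ s, ‖taylorCoeff g k‖ ^ 2) * (∑ k ∈ s, (‖z‖ ^ k) ^ 2) :=
        Finset.sum_mul_sq_le_sq_mul_sq _ _ _
    _ ≤ h2NormSq g * (1 - ‖z‖ ^ 2)⁻¹ := by
        have h1 : ∑ k ∈ s, ‖taylorCoeff g k‖ ^ 2 ≤ h2NormSq g :=
          hg.2.sum_le_tsum s (fun _ _ => by positivity)
        have h2 : ∑ k ∈ s, (‖z‖ ^ k) ^ 2 ≤ (1 - ‖z‖ ^ 2)⁻¹ := by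
          rw [← tsum_geometric_of_lt_one (by positivity) hq]
          have e : ∀ k, (‖z‖ ^ k) ^ 2 = (‖z‖ ^ 2) ^ k := fun k => by ring
          simp only [e]
          exact (summable_geometric_of_lt_one (by positivity) hq).sum_le_tsum s
            (fun _ _ => by positivity)
        have h3 : 0 ≤ h2NormSq g := tsum_nonneg fun _ => by positivity
        gcongr
    _ = _ := by rw [div_eq_mul_inv]

theorem h2NormSq_nonneg (g : ℂ → ℂ) : 0 ≤ h2NormSq g := tsum_nonneg fun _ => by positivity

theorem taylorCoeff_eq {f : ℂ → ℂ} (hf : DifferentiableOn ℂ f unitDisk) {c : ℕ → ℂ}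
    (h : ∀ z ∈ unitDisk, HasSum (fun k => c k * z ^ k) (f z)) (k : ℕ) :
    taylorCoeff f k = c k := by
  have h0 : unitDisk ∈ nhds (0:ℂ) := isOpen_unitDisk.mem_nhds (by simp [unitDisk])
  have h1 : HasFPowerSeriesAt f (FormalMultilinearSeries.ofScalars ℂ c) 0 := by
    rw [hasFPowerSeriesAt_iff]
    filter_upwards [h0] with z hz
    simpa [FormalMultilinearSeries.coeff_ofScalars, mul_comm] using h z hz
  have h2 : HasFPowerSeriesAt f (FormalMultilinearSeries.ofScalars ℂ (taylorCoeff f)) 0 := by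
    rw [hasFPowerSeriesAt_iff]
    filter_upwards [h0] with z hz
    simpa [FormalMultilinearSeries.coeff_ofScalars, mul_comm] using taylor_hasSum hf hz
  have h3 := congrArg (fun p => FormalMultilinearSeries.coeff p k)
    (h2.eq_formalMultilinearSeries h1)
  simpa [FormalMultilinearSeries.coeff_ofScalars] using h3

theorem taylorCoeff_poly (q : Polynomial ℂ) (k : ℕ) :
    taylorCoeff (fun z => q.eval z) k = q.coeff k := by
  refine taylorCoeff_eq (q.differentiable.differentiableOn) (fun z _ => ?_) k
  rw [Polynomial.eval_eq_sum_range]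
  apply hasSum_sum_of_ne_finset_zero
  intro i hi
  rw [Polynomial.coeff_eq_zero_of_natDegree_lt (by simpa using hi), zero_mul]

theorem memH2_congr {f g : ℂ → ℂ} (h : ∀ z ∈ unitDisk, f z = g z) (k : ℕ) :
    taylorCoeff f k = taylorCoeff g k := by
  have h0 : unitDisk ∈ nhds (0:ℂ) := isOpen_unitDisk.mem_nhds (by simp [unitDisk])
  have : f =ᶠ[nhds 0] g := by filter_upwards [h0] with z hz using h z hz
  unfold taylorCoeff
  rw [this.iteratedDeriv_eq]

/-- The Szegő kernel. -/
def szego (w : ℂ) : ℂ → ℂ := fun z => (1 - (starRingEnd ℂ) w * z)⁻¹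

theorem szego_diff {w : ℂ} (hw : w ∈ unitDisk) : DifferentiableOn ℂ (szego w) unitDisk := by
  intro z hz
  have := one_sub_conj_mul_ne (mem_unitDisk_iff.1 hz) (mem_unitDisk_iff.1 hw)
  apply DifferentiableAt.differentiableWithinAt
  unfold szego
  fun_prop (disch := assumption)

theorem szego_coeff {w : ℂ} (hw : w ∈ unitDisk) (k : ℕ) :
    taylorCoeff (szego w) k = (starRingEnd ℂ) w ^ k := by
  refine taylorCoeff_eq (szego_diff hw) (fun z hz => ?_) k
  have h : ‖(starRingEnd ℂ) w * z‖ < 1 := by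
    rw [norm_mul, RCLike.norm_conj]
    have := mem_unitDisk_iff.1 hz
    have := mem_unitDisk_iff.1 hw
    nlinarith [norm_nonneg z, norm_nonneg w]
  simpa [mul_pow, szego] using hasSum_geometric_of_norm_lt_one h

theorem szego_hasSum {w : ℂ} (hw : w ∈ unitDisk) :
    HasSum (fun k => ‖taylorCoeff (szego w) k‖ ^ 2) (1 - ‖w‖ ^ 2)⁻¹ := by
  have hq : ‖w‖ ^ 2 < 1 := by nlinarith [norm_nonneg w, mem_unitDisk_iff.1 hw]
  refine (hasSum_geometric_of_lt_one (by positivity) hq).congr_fun ?_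
  intro k
  rw [szego_coeff hw, norm_pow, RCLike.norm_conj]; ring

theorem log_memH2 {η : ℂ} (hη : ‖η‖ = 1) :
    MemH2 (fun z => - Complex.log (1 - (starRingEnd ℂ) η * z)) := by
  have hd : DifferentiableOn ℂ (fun z => - Complex.log (1 - (starRingEnd ℂ) η * z)) unitDisk := by
    intro z hz
    apply DifferentiableAt.differentiableWithinAt
    apply DifferentiableAt.neg
    apply DifferentiableAt.clog (by fun_prop)
    left
    have h1 := Complex.re_le_norm ((starRingEnd ℂ) η * z)
    rw [norm_mul, RCLike.norm_conj, hη, one_mul] at h1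
    have := mem_unitDisk_iff.1 hz
    simp only [Complex.sub_re, Complex.one_re]; linarith
  refine ⟨hd, ?_⟩
  have hco : ∀ k, taylorCoeff (fun z => - Complex.log (1 - (starRingEnd ℂ) η * z)) k
      = (starRingEnd ℂ) η ^ k / k := by
    refine taylorCoeff_eq hd (fun z hz => ?_)
    have h : ‖(starRingEnd ℂ) η * z‖ < 1 := by
      rw [norm_mul, RCLike.norm_conj, hη, one_mul]; exact mem_unitDisk_iff.1 hz
    refine (Complex.hasSum_taylorSeries_neg_log h).congr_fun ?_
    intro k
    rw [mul_pow]; ring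
  have : (fun k : ℕ => ‖taylorCoeff (fun z => - Complex.log (1 - (starRingEnd ℂ) η * z)) k‖ ^ 2)
      = fun k : ℕ => 1 / (k : ℝ) ^ 2 := by
    funext k
    rw [hco, norm_div, norm_pow, RCLike.norm_conj, hη]
    simp
  rw [this]
  exact Real.summable_one_div_nat_pow.2 (by norm_num)

theorem dvd_of_growth {q : Polynomial ℂ} {ξ : ℂ} (hξ : ‖ξ‖ = 1) {s : ℕ} {C : ℝ}
    (h : ∀ᶠ r : ℝ in nhdsWithin 1 (Iio 1),
      ‖q.eval ((r : ℂ) * ξ)‖ ^ 2 * (1 - r) ≤ C * (1 - r) ^ (2 * s)) :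
    (Polynomial.X - Polynomial.C ξ) ^ s ∣ q := by
  by_cases hq : q = 0
  · simp [hq]
  obtain ⟨p, hp, hnd⟩ := Polynomial.exists_eq_pow_rootMultiplicity_mul_and_not_dvd q hq ξ
  set j := q.rootMultiplicity ξ with hj
  by_cases hjs : s ≤ j
  · rw [hp]; exact (pow_dvd_pow _ hjs).mul_right p
  exfalso
  push Not at hjs
  rw [Polynomial.dvd_iff_isRoot, Polynomial.IsRoot.def] at hnd
  obtain ⟨e, he⟩ : ∃ e, s = j + 1 + e := ⟨s - (j + 1), by omega⟩
  have hev : ∀ᶠ r : ℝ in nhdsWithin 1 (Iio 1), ‖p.eval ((r : ℂ) * ξ)‖ ^ 2 ≤ C * (1 - r) ^ (2 * e + 1) := by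
    filter_upwards [h, self_mem_nhdsWithin] with r hr hr1
    have h1r : 0 < 1 - r := by simp at hr1; linarith
    have e1 : ‖(r : ℂ) * ξ - ξ‖ = 1 - r := by
      have h2 : (r : ℂ) * ξ - ξ = -(((1 - r : ℝ) : ℂ) * ξ) := by push_cast; ring
      rw [h2, norm_neg, norm_mul, hξ, Complex.norm_real, Real.norm_of_nonneg h1r.le, mul_one]
    rw [hp] at hr
    simp only [Polynomial.eval_mul, Polynomial.eval_pow, Polynomial.eval_sub, Polynomial.eval_X,
      Polynomial.eval_C, norm_mul, norm_pow] at hr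
    rw [e1, he] at hr
    have h3 : 0 < (1 - r) ^ (2 * j + 1) := by positivity
    apply le_of_mul_le_mul_right _ h3
    calc _ = ((1 - r) ^ j * ‖p.eval ((r : ℂ) * ξ)‖) ^ 2 * (1 - r) := by ring
      _ ≤ _ := hr
      _ = _ := by ring
  have hl1 : Tendsto (fun r : ℝ => ‖p.eval ((r : ℂ) * ξ)‖ ^ 2) (nhdsWithin 1 (Iio 1))
      (nhds (‖p.eval ξ‖ ^ 2)) := by
    have : Continuous (fun r : ℝ => ‖p.eval ((r : ℂ) * ξ)‖ ^ 2) := by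
      have := p.continuous
      fun_prop
    have h := (this.tendsto 1).mono_left (nhdsWithin_le_nhds (s := Iio 1))
    simpa using h
  have hl2 : Tendsto (fun r : ℝ => C * (1 - r) ^ (2 * e + 1)) (nhdsWithin 1 (Iio 1)) (nhds 0) := by
    have : Continuous (fun r : ℝ => C * (1 - r) ^ (2 * e + 1)) := by fun_prop
    have h := (this.tendsto 1).mono_left (nhdsWithin_le_nhds (s := Iio 1))
    simpa using h
  have := le_of_tendsto_of_tendsto hl1 hl2 hev
  have := pow_pos (norm_pos_iff.2 hnd) 2
  linarith

theorem radial_norms {ξ : ℂ} (hξ : ‖ξ‖ = 1) {r : ℝ} (h0 : 0 < r) (h1 : r < 1) :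
    ‖(r : ℂ) * ξ‖ = r ∧ (r : ℂ) * ξ ∈ unitDisk ∧ ‖(r : ℂ) * ξ - ξ‖ = 1 - r := by
  have e1 : ‖(r : ℂ) * ξ‖ = r := by
    rw [norm_mul, hξ, Complex.norm_real, Real.norm_of_nonneg h0.le, mul_one]
  refine ⟨e1, mem_unitDisk_iff.2 (by rw [e1]; exact h1), ?_⟩
  have h2 : (r : ℂ) * ξ - ξ = -(((1 - r : ℝ) : ℂ) * ξ) := by push_cast; ring
  rw [h2, norm_neg, norm_mul, hξ, Complex.norm_real, Real.norm_of_nonneg (by linarith), mul_one]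

theorem a1fun_split {n : ℕ} (ξ : Fin n → ℂ) (m : Fin n → ℕ) (k : Fin n) (z : ℂ) :
    a1fun ξ m z = (z - ξ k) ^ m k * ∏ j ∈ Finset.univ.erase k, (z - ξ j) ^ m j := by
  unfold a1fun
  rw [Finset.mul_prod_erase _ (fun j => (z - ξ j) ^ m j) (Finset.mem_univ k)]

theorem a1fun_upper {n : ℕ} (ξ : Fin n → ℂ) (m : Fin n → ℕ) (hξ : ∀ j, ‖ξ j‖ = 1) (k : Fin n) :
    ∃ A > 0, ∀ z, ‖z‖ < 1 → ‖a1fun ξ m z‖ ≤ A * ‖z - ξ k‖ ^ m k := by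
  refine ⟨∏ j ∈ Finset.univ.erase k, 2 ^ m j, by positivity, fun z hz => ?_⟩
  rw [a1fun_split ξ m k, norm_mul, norm_pow, mul_comm, norm_prod]
  gcongr with j hj
  rw [norm_pow]
  gcongr
  have := norm_sub_le z (ξ j)
  rw [hξ] at this; linarith

theorem a1fun_lower {n : ℕ} (ξ : Fin n → ℂ) (m : Fin n → ℕ) (hinj : Function.Injective ξ)
    (k : Fin n) : ∃ c > 0, ∀ᶠ z in nhds (ξ k), c * ‖z - ξ k‖ ^ m k ≤ ‖a1fun ξ m z‖ := by
  set R : ℂ → ℂ := fun z => ∏ j ∈ Finset.univ.erase k, (z - ξ j) ^ m j with hR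
  have hRc : Continuous R := by simp only [hR]; fun_prop
  have hR0 : R (ξ k) ≠ 0 := by
    simp only [hR]
    rw [Finset.prod_ne_zero_iff]
    intro j hj
    apply pow_ne_zero
    rw [sub_ne_zero]
    exact fun h => (Finset.ne_of_mem_erase hj) (hinj h).symm
  have hpos := norm_pos_iff.2 hR0
  refine ⟨‖R (ξ k)‖ / 2, by positivity, ?_⟩
  have hev : ∀ᶠ z in nhds (ξ k), ‖R (ξ k)‖ / 2 < ‖R z‖ :=
    (hRc.norm.tendsto (ξ k)).eventually_const_lt (by linarith)
  filter_upwards [hev] with z hz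
  rw [a1fun_split ξ m k, norm_mul, norm_pow, mul_comm]
  gcongr

theorem a1g_bound {n : ℕ} (ξ : Fin n → ℂ) (m : Fin n → ℕ) {k : Fin n} (hξ : ‖ξ k‖ = 1) {A : ℝ}
    (hA : ∀ z, ‖z‖ < 1 → ‖a1fun ξ m z‖ ≤ A * ‖z - ξ k‖ ^ m k) {g : ℂ → ℂ} (hg : MemH2 g)
    {r : ℝ} (h0 : 0 < r) (h1 : r < 1) :
    ‖a1fun ξ m (r * ξ k) * g (r * ξ k)‖ ^ 2 * (1 - r) ≤
      A ^ 2 * h2NormSq g * (1 - r) ^ (2 * m k) := by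
  obtain ⟨e1, e2, e3⟩ := radial_norms hξ h0 h1
  have hgr := h2_growth hg e2
  rw [e1] at hgr
  have ha := hA _ (mem_unitDisk_iff.1 e2)
  rw [e3] at ha
  rw [norm_mul, mul_pow]
  calc ‖a1fun ξ m (r * ξ k)‖ ^ 2 * ‖g (r * ξ k)‖ ^ 2 * (1 - r)
      = ‖a1fun ξ m (r * ξ k)‖ ^ 2 * (‖g (r * ξ k)‖ ^ 2 * (1 - r)) := by ring
    _ ≤ (A * (1 - r) ^ m k) ^ 2 * (‖g (r * ξ k)‖ ^ 2 * (1 - r ^ 2)) := by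
        have : 1 - r ≤ 1 - r ^ 2 := by nlinarith
        have : 0 ≤ 1 - r := by linarith
        gcongr
    _ ≤ (A * (1 - r) ^ m k) ^ 2 * h2NormSq g := by gcongr
    _ = _ := by ring

theorem hb_unique {n : ℕ} {ξ : Fin n → ℂ} {m : Fin n → ℕ} (hξ : ∀ j, ‖ξ j‖ = 1)
    (hinj : Function.Injective ξ) {f g₁ g₂ : ℂ → ℂ} {q₁ q₂ : Polynomial ℂ}
    (h₁ : HbDecompOf ξ m f g₁ q₁) (h₂ : HbDecompOf ξ m f g₂ q₂) :
    q₁ = q₂ ∧ ∀ z ∈ unitDisk, g₁ z = g₂ z := by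
  have hq : q₁ - q₂ = 0 := by
    have hdvd : (∏ j, (Polynomial.X - Polynomial.C (ξ j)) ^ m j) ∣ q₁ - q₂ := by
      apply Fintype.prod_dvd_of_coprime
      · intro i j hij
        exact (Polynomial.pairwise_coprime_X_sub_C hinj hij).pow
      · intro k
        obtain ⟨A, hA0, hA⟩ := a1fun_upper ξ m hξ k
        apply dvd_of_growth (hξ k) (C := 2 * (A ^ 2 * h2NormSq g₁ + A ^ 2 * h2NormSq g₂))
        filter_upwards [Ioo_mem_nhdsLT (show (0:ℝ) < 1 by norm_num)] with r hr
        have b1 := a1g_bound ξ m (hξ k) hA h₁.1 hr.1 hr.2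
        have b2 := a1g_bound ξ m (hξ k) hA h₂.1 hr.1 hr.2
        obtain ⟨e1, e2, e3⟩ := radial_norms (hξ k) hr.1 hr.2
        have e4 : (q₁ - q₂).eval ((r:ℂ) * ξ k) = a1fun ξ m (r * ξ k) * g₂ (r * ξ k)
            - a1fun ξ m (r * ξ k) * g₁ (r * ξ k) := by
          rw [Polynomial.eval_sub]
          linear_combination h₂.2.2 _ e2 - h₁.2.2 _ e2
        have h1r : 0 ≤ 1 - r := by linarith [hr.2]
        have e5 : ‖(q₁ - q₂).eval ((r:ℂ) * ξ k)‖ ^ 2 ≤ 2 * (‖a1fun ξ m (r * ξ k) * g₂ (r * ξ k)‖ ^ 2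
            + ‖a1fun ξ m (r * ξ k) * g₁ (r * ξ k)‖ ^ 2) := by
          rw [e4]
          have h3 := norm_sub_le (a1fun ξ m (r * ξ k) * g₂ (r * ξ k))
            (a1fun ξ m (r * ξ k) * g₁ (r * ξ k))
          have h4 := pow_le_pow_left₀ (norm_nonneg _) h3 2
          nlinarith [sq_nonneg (‖a1fun ξ m (r * ξ k) * g₂ (r * ξ k)‖
            - ‖a1fun ξ m (r * ξ k) * g₁ (r * ξ k)‖)]
        have := mul_le_mul_of_nonneg_right e5 h1r
        nlinarith
    apply Polynomial.eq_zero_of_dvd_of_degree_lt hdvd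
    have hdeg : (∏ j, (Polynomial.X - Polynomial.C (ξ j)) ^ m j).degree
        = ((∑ j, m j : ℕ) : WithBot ℕ) := by
      rw [Polynomial.degree_prod]
      simp [Polynomial.degree_pow, Polynomial.degree_X_sub_C]
    rw [hdeg]
    exact (Polynomial.degree_sub_le _ _).trans_lt (max_lt h₁.2.1 h₂.2.1)
  have hqq := sub_eq_zero.1 hq
  refine ⟨hqq, fun z hz => ?_⟩
  have hne : a1fun ξ m z ≠ 0 := by
    unfold a1fun
    rw [Finset.prod_ne_zero_iff]
    intro j _
    apply pow_ne_zero
    have := sub_ne_of_circle (hξ j) (mem_unitDisk_iff.1 hz)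
    intro h; apply this; linear_combination -h
  have h3 := h₁.2.2 z hz
  have h4 := h₂.2.2 z hz
  rw [hqq] at h3
  apply mul_left_cancel₀ hne
  linear_combination h4 - h3

theorem hbNormSq_eq {n : ℕ} {ξ : Fin n → ℂ} {m : Fin n → ℕ} (hξ : ∀ j, ‖ξ j‖ = 1)
    (hinj : Function.Injective ξ) {f g : ℂ → ℂ} {q : Polynomial ℂ}
    (h : HbDecompOf ξ m f g q) :
    hbNormSq ξ m f = h2NormSq g + h2NormSq fun z => q.eval z := by
  have hm : MemHb ξ m f := ⟨(g, q), h⟩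
  have hs : HbDecompOf ξ m f (hbDecomp ξ m f).1 (hbDecomp ξ m f).2 := by
    unfold hbDecomp
    rw [dif_pos hm]
    exact hm.choose_spec
  obtain ⟨e1, e2⟩ := hb_unique hξ hinj hs h
  unfold hbNormSq
  rw [e1]
  congr 1
  unfold h2NormSq
  simp only [memH2_congr e2]

theorem evIoo : ∀ᶠ r : ℝ in nhdsWithin 1 (Iio 1), r ∈ Ioo (0:ℝ) 1 :=
  Ioo_mem_nhdsLT (by norm_num)

theorem a1g_tendsto {n : ℕ} (ξ : Fin n → ℂ) (m : Fin n → ℕ) (hξ : ∀ j, ‖ξ j‖ = 1) (k : Fin n)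
    (hm : 0 < m k) {g : ℂ → ℂ} (hg : MemH2 g) :
    Tendsto (fun r : ℝ => a1fun ξ m (r * ξ k) * g (r * ξ k)) (nhdsWithin 1 (Iio 1)) (nhds 0) := by
  obtain ⟨A, hA0, hA⟩ := a1fun_upper ξ m hξ k
  obtain ⟨e, he⟩ : ∃ e, m k = e + 1 := ⟨m k - 1, by omega⟩
  have hl2 : Tendsto (fun r : ℝ => A ^ 2 * h2NormSq g * (1 - r) ^ (2 * e + 1))
      (nhdsWithin 1 (Iio 1)) (nhds 0) := by
    have : Continuous (fun r : ℝ => A ^ 2 * h2NormSq g * (1 - r) ^ (2 * e + 1)) := by fun_prop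
    have h := (this.tendsto 1).mono_left (nhdsWithin_le_nhds (s := Iio 1))
    simpa using h
  have hsq : Tendsto (fun r : ℝ => ‖a1fun ξ m (r * ξ k) * g (r * ξ k)‖ ^ 2)
      (nhdsWithin 1 (Iio 1)) (nhds 0) := by
    refine tendsto_of_tendsto_of_tendsto_of_le_of_le' tendsto_const_nhds hl2
      (Eventually.of_forall fun r => by positivity) ?_
    filter_upwards [evIoo] with r hr
    have b := a1g_bound ξ m (hξ k) hA hg hr.1 hr.2
    have h1r : 0 < 1 - r := by linarith [hr.2]
    apply le_of_mul_le_mul_right _ h1r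
    refine b.trans (le_of_eq ?_)
    rw [he]; ring
  have h2 := hsq.sqrt
  simp only [Real.sqrt_sq (norm_nonneg _), Real.sqrt_zero] at h2
  exact tendsto_zero_iff_norm_tendsto_zero.2 h2

theorem poly_radial_tendsto (q : Polynomial ℂ) (ξ : ℂ) :
    Tendsto (fun r : ℝ => q.eval ((r : ℂ) * ξ)) (nhdsWithin 1 (Iio 1)) (nhds (q.eval ξ)) := by
  have : Continuous (fun r : ℝ => q.eval ((r : ℂ) * ξ)) := by
    have := q.continuous
    fun_prop
  have h := (this.tendsto 1).mono_left (nhdsWithin_le_nhds (s := Iio 1))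
  simpa using h

theorem poly_dvd_bound {q : Polynomial ℂ} {ξ : ℂ} (hξ : ‖ξ‖ = 1) {s : ℕ}
    (h : (Polynomial.X - Polynomial.C ξ) ^ s ∣ q) :
    ∃ K ≥ 0, ∀ᶠ r : ℝ in nhdsWithin 1 (Iio 1), ‖q.eval ((r : ℂ) * ξ)‖ ≤ K * (1 - r) ^ s := by
  obtain ⟨p, rfl⟩ := h
  refine ⟨‖p.eval ξ‖ + 1, by positivity, ?_⟩
  have h1 := (poly_radial_tendsto p ξ).norm.eventually_lt_const
    (show ‖p.eval ξ‖ < ‖p.eval ξ‖ + 1 by linarith)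
  filter_upwards [h1, evIoo] with r hr1 hr
  obtain ⟨_, _, e3⟩ := radial_norms hξ hr.1 hr.2
  have : 0 < 1 - r := by linarith [hr.2]
  simp only [Polynomial.eval_mul, Polynomial.eval_pow, Polynomial.eval_sub, Polynomial.eval_X,
    Polynomial.eval_C, norm_mul, norm_pow] at hr1 ⊢
  rw [e3, mul_comm]
  gcongr

theorem radial_phi {φ : ℂ → ℂ} {ξ η : ℂ} (hξ : ‖ξ‖ = 1) (h : NTLimit φ ξ η) :
    Tendsto (fun r : ℝ => φ (r * ξ)) (nhdsWithin 1 (Iio 1)) (nhds η) :=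
  (h 2 (by norm_num)).comp (radial_tendsto hξ (by norm_num))

/-- If `m k ≥ 2` then every `φ ∈ H(b)` satisfies a radial Lipschitz bound at `ξ k`. -/
theorem linear_bound {n : ℕ} {ξ : Fin n → ℂ} {m : Fin n → ℕ} (hξ : ∀ j, ‖ξ j‖ = 1) {k : Fin n}
    (hm : 2 ≤ m k) {φ : ℂ → ℂ} {η : ℂ} (hφ : MemHb ξ m φ) (hlim : NTLimit φ (ξ k) η) :
    ∃ C ≥ 0, ∀ᶠ r : ℝ in nhdsWithin 1 (Iio 1), ‖φ (r * ξ k) - η‖ ≤ C * (1 - r) := by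
  obtain ⟨⟨h, q⟩, hh, -, heq⟩ := hφ
  simp only at hh heq
  have hqη : q.eval (ξ k) = η := by
    have h1 := (a1g_tendsto ξ m hξ k (by omega) hh).add (poly_radial_tendsto q (ξ k))
    have h2 := radial_phi (hξ k) hlim
    rw [zero_add] at h1
    refine tendsto_nhds_unique (h1.congr' ?_) h2
    filter_upwards [evIoo] with r hr
    exact (heq _ (radial_norms (hξ k) hr.1 hr.2).2.1).symm
  obtain ⟨K, hK0, hK⟩ := poly_dvd_bound (q := q - Polynomial.C η) (s := 1) (hξ k) (by
    rw [pow_one, Polynomial.dvd_iff_isRoot]; simp [hqη])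
  obtain ⟨A, hA0, hA⟩ := a1fun_upper ξ m hξ k
  have hB := h2NormSq_nonneg h
  refine ⟨K + √(A ^ 2 * h2NormSq h), by positivity, ?_⟩
  filter_upwards [hK, evIoo] with r hKr hr
  have b := a1g_bound ξ m (hξ k) hA hh hr.1 hr.2
  have h1r : 0 < 1 - r := by linarith [hr.2]
  obtain ⟨e, he⟩ : ∃ e, m k = e + 2 := ⟨m k - 2, by omega⟩
  have b2 : ‖a1fun ξ m (r * ξ k) * h (r * ξ k)‖ ^ 2 ≤ (√(A ^ 2 * h2NormSq h) * (1 - r)) ^ 2 := by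
    rw [mul_pow, Real.sq_sqrt (by positivity)]
    apply le_of_mul_le_mul_right _ h1r
    refine b.trans ?_
    rw [he, mul_assoc, mul_assoc, mul_assoc]
    gcongr
    calc (1 - r) ^ (2 * (e + 2)) = (1 - r) ^ 3 * (1 - r) ^ (2 * e + 1) := by ring
      _ ≤ (1 - r) ^ 3 * 1 := by
        gcongr; exact pow_le_one₀ h1r.le (by linarith [hr.1])
      _ = _ := by ring
  have b3 := le_of_sq_le_sq b2 (by positivity)
  rw [heq _ (radial_norms (hξ k) hr.1 hr.2).2.1]
  have e1 : a1fun ξ m (r * ξ k) * h (r * ξ k) + q.eval (r * ξ k) - η =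
    a1fun ξ m (r * ξ k) * h (r * ξ k) + (q - Polynomial.C η).eval (r * ξ k) := by
    simp; ring
  rw [e1]
  have := norm_add_le (a1fun ξ m (r * ξ k) * h (r * ξ k)) ((q - Polynomial.C η).eval (r * ξ k))
  rw [pow_one] at hKr
  linarith

theorem norm_one_sub_conj {η w : ℂ} (hη : ‖η‖ = 1) : ‖1 - (starRingEnd ℂ) η * w‖ = ‖w - η‖ := by
  have h1 : (starRingEnd ℂ) η * η = 1 := by
    rw [mul_comm, Complex.mul_conj, Complex.normSq_eq_norm_sq, hη]; simp
  have : 1 - (starRingEnd ℂ) η * w = -((starRingEnd ℂ) η * (w - η)) := by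
    linear_combination -h1
  rw [this, norm_neg, norm_mul, RCLike.norm_conj, hη, one_mul]

theorem mult_le {n : ℕ} {ξ : Fin n → ℂ} {m : Fin n → ℕ} (hξ : ∀ j, ‖ξ j‖ = 1)
    (hinj : Function.Injective ξ) (hmpos : ∀ j, 0 < m j) {k l : Fin n} {φ : ℂ → ℂ}
    (hφ : MemHb ξ m φ) (hd : DifferentiableOn ℂ φ unitDisk)
    (hmap : ∀ z ∈ unitDisk, φ z ∈ unitDisk) (hlim : NTLimit φ (ξ k) (ξ l))
    (hcomp : ∀ f, MemHb ξ m f → MemHb ξ m fun z => f (φ z)) : m k ≤ m l := by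
  by_contra! hlt
  have hl0 := hmpos l
  set s := m l with hs
  obtain ⟨C, hC0, hC⟩ := linear_bound hξ (by omega) hφ hlim
  obtain ⟨c₁, hc₁, hlow⟩ := one_sub_norm_lower hd hmap
  obtain ⟨A, hA0, hA⟩ := a1fun_upper ξ m hξ k
  obtain ⟨A', hA'0, hA'⟩ := a1fun_upper ξ m hξ l
  obtain ⟨c₂, hc₂, hlow2⟩ := a1fun_lower ξ m hinj l
  have hη := hξ l
  set η := ξ l with hηdef
  set h : ℂ → ℂ := fun z => - Complex.log (1 - (starRingEnd ℂ) η * z) with hh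
  have hH2 : MemH2 h := log_memH2 hη
  have hmem : MemHb ξ m (fun z => a1fun ξ m z * h z) :=
    ⟨(h, 0), hH2, by simp only [Polynomial.degree_zero]; exact WithBot.bot_lt_coe _, by simp⟩
  obtain ⟨⟨g, q⟩, hg, -, heq⟩ := hcomp _ hmem
  simp only at hg heq
  have hrad := radial_phi (hξ k) hlim
  set H := h2NormSq h with hHdef
  have hH0 : 0 ≤ H := h2NormSq_nonneg h
  set B := A ^ 2 * h2NormSq g with hBdef
  have hB0 : 0 ≤ B := mul_nonneg (by positivity) (h2NormSq_nonneg g)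
  -- pointwise facts
  have hdvd : (Polynomial.X - Polynomial.C (ξ k)) ^ s ∣ q := by
    apply dvd_of_growth (hξ k) (C := 2 * ((A' * C ^ s) ^ 2 * (H / c₁) + B))
    filter_upwards [hC, evIoo] with r hCr hr
    have h1r : 0 < 1 - r := by linarith [hr.2]
    obtain ⟨e1, e2, e3⟩ := radial_norms (hξ k) hr.1 hr.2
    have hw := mem_unitDisk_iff.1 (hmap _ e2)
    have b := a1g_bound ξ m (hξ k) hA hg hr.1 hr.2
    have hlo := hlow _ e2
    rw [e1] at hlo
    have hgr := h2_growth hH2 (hmap _ e2)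
    have hup := hA' _ hw
    have heq' := heq _ e2
    set w := φ (r * ξ k) with hwdef
    set X := a1fun ξ m w * h w with hX
    set Y := a1fun ξ m (r * ξ k) * g (r * ξ k) with hY
    have hhw : ‖h w‖ ^ 2 * (1 - r) ≤ H / c₁ := by
      rw [le_div_iff₀ hc₁]
      refine le_trans ?_ hgr
      rw [mul_assoc]
      gcongr
      nlinarith [norm_nonneg w]
    have hXb : ‖X‖ ^ 2 * (1 - r) ≤ (A' * C ^ s) ^ 2 * (H / c₁) * (1 - r) ^ (2 * s) := by
      rw [hX, norm_mul]
      calc (‖a1fun ξ m w‖ * ‖h w‖) ^ 2 * (1 - r) = ‖a1fun ξ m w‖ ^ 2 * (‖h w‖ ^ 2 * (1 - r)) := by ring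
        _ ≤ (A' * (C * (1 - r)) ^ s) ^ 2 * (H / c₁) := by
          gcongr
          exact hup.trans (by gcongr)
        _ = _ := by rw [mul_pow C]; ring
    have hYb : ‖Y‖ ^ 2 * (1 - r) ≤ B * (1 - r) ^ (2 * s) := by
      refine b.trans ?_
      gcongr ?_ * ?_
      exact pow_le_pow_of_le_one h1r.le (by linarith [hr.1]) (by omega)
    have hq : q.eval ((r:ℂ) * ξ k) = X - Y := by linear_combination -heq'
    have h4 := pow_le_pow_left₀ (norm_nonneg _) (norm_sub_le X Y) 2
    have h5 : ‖X - Y‖ ^ 2 ≤ 2 * (‖X‖ ^ 2 + ‖Y‖ ^ 2) := by nlinarith [sq_nonneg (‖X‖ - ‖Y‖)]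
    rw [hq]
    have := mul_le_mul_of_nonneg_right h5 h1r.le
    nlinarith
  obtain ⟨K, hK0, hK⟩ := poly_dvd_bound (hξ k) hdvd
  set K2 := (K + √B) / (c₂ * c₁ ^ s) with hK2
  have hsmall : ∀ᶠ r : ℝ in nhdsWithin 1 (Iio 1), ‖φ (r * ξ k) - η‖ < Real.exp (-(K2 + 1)) := by
    have h1 := (hrad.sub_const η).norm
    rw [sub_self, norm_zero] at h1
    exact h1.eventually_lt_const (Real.exp_pos _)
  obtain ⟨r, hKr, hsm, hl2, hr⟩ := (hK.and (hsmall.and ((hrad.eventually hlow2).and evIoo))).exists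
  have h1r : 0 < 1 - r := by linarith [hr.2]
  obtain ⟨e1, e2, e3⟩ := radial_norms (hξ k) hr.1 hr.2
  have hw := mem_unitDisk_iff.1 (hmap _ e2)
  have b := a1g_bound ξ m (hξ k) hA hg hr.1 hr.2
  have hlo := hlow _ e2
  rw [e1] at hlo
  have heq' := heq _ e2
  set w := φ (r * ξ k) with hwdef
  have hYb : ‖a1fun ξ m (r * ξ k) * g (r * ξ k)‖ ≤ √B * (1 - r) ^ s := by
    apply le_of_sq_le_sq _ (by positivity)
    rw [mul_pow, Real.sq_sqrt hB0]
    apply le_of_mul_le_mul_right _ h1r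
    have hpw : (1 - r) ^ (2 * m k) ≤ ((1 - r) ^ s) ^ 2 * (1 - r) := by
      rw [← pow_mul, ← pow_succ]
      exact pow_le_pow_of_le_one h1r.le (by linarith [hr.1]) (by omega)
    calc _ ≤ B * (1 - r) ^ (2 * m k) := b
      _ ≤ B * (((1 - r) ^ s) ^ 2 * (1 - r)) := mul_le_mul_of_nonneg_left hpw hB0
      _ = _ := by ring
  have hXb : ‖a1fun ξ m w * h w‖ ≤ (K + √B) * (1 - r) ^ s := by
    rw [heq']
    refine (norm_add_le _ _).trans ?_
    linarith
  have hdist : c₁ * (1 - r) ≤ ‖w - η‖ := by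
    have := norm_sub_norm_le η w
    rw [hη, norm_sub_rev] at this
    linarith
  have hhb : ‖h w‖ ≤ K2 := by
    rw [hK2, le_div_iff₀ (by positivity)]
    have hp : 0 < (1 - r) ^ s := by positivity
    apply le_of_mul_le_mul_right _ hp
    refine le_trans ?_ hXb
    rw [norm_mul]
    calc ‖h w‖ * (c₂ * c₁ ^ s) * (1 - r) ^ s = (c₂ * (c₁ * (1 - r)) ^ s) * ‖h w‖ := by
          rw [mul_pow]; ring
      _ ≤ (c₂ * ‖w - η‖ ^ s) * ‖h w‖ := by gcongr
      _ ≤ _ := by gcongr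
  have hwpos : 0 < ‖w - η‖ := lt_of_lt_of_le (by positivity) hdist
  have hlog : Real.log ‖w - η‖ < -(K2 + 1) := by
    rw [Real.log_lt_iff_lt_exp hwpos]; exact hsm
  have hre : -Real.log ‖w - η‖ ≤ ‖h w‖ := by
    have := Complex.re_le_norm (h w)
    simp only [hh, Complex.neg_re, Complex.log_re, norm_one_sub_conj hη] at this
    exact this
  linarith

theorem poly_diff_bound {q : Polynomial ℂ} {N : ℕ} (hq : q.degree < (N : WithBot ℕ)) {ξ : ℂ}
    (hξ : ‖ξ‖ = 1) (h0 : q.eval ξ = 0) {r : ℝ} (hr0 : 0 < r) (hr1 : r < 1) {T : ℝ} (hT0 : 0 ≤ T)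
    (hT : h2NormSq (fun z => q.eval z) ≤ T) :
    ‖q.eval ((r : ℂ) * ξ)‖ ≤ (N : ℝ) ^ 2 * (1 - r) * √T := by
  have hsupp : Summable fun k => ‖taylorCoeff (fun z => q.eval z) k‖ ^ 2 := by
    apply summable_of_ne_finset_zero (s := Finset.range N)
    intro i hi
    rw [taylorCoeff_poly, Polynomial.coeff_eq_zero_of_degree_lt]
    · simp
    · exact hq.trans_le (by simpa using hi)
  have hco : ∀ i, ‖q.coeff i‖ ≤ √T := by
    intro i
    apply Real.le_sqrt_of_sq_le
    refine le_trans ?_ hT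
    have := hsupp.le_tsum i (fun _ _ => by positivity)
    rwa [taylorCoeff_poly] at this
  have hev : ∀ z, q.eval z = ∑ i ∈ Finset.range N, q.coeff i * z ^ i := by
    intro z
    by_cases hq0 : q = 0
    · simp [hq0]
    · exact Polynomial.eval_eq_sum_range' ((Polynomial.natDegree_lt_iff_degree_lt hq0).2 hq) z
  have e : q.eval ((r : ℂ) * ξ) = ∑ i ∈ Finset.range N, q.coeff i * (((r : ℂ) ^ i - 1) * ξ ^ i) := by
    rw [← sub_zero (q.eval ((r : ℂ) * ξ)), ← h0, hev, hev, ← Finset.sum_sub_distrib]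
    refine Finset.sum_congr rfl fun i _ => ?_
    rw [mul_pow]; ring
  rw [e]
  calc _ ≤ ∑ i ∈ Finset.range N, ‖q.coeff i * (((r : ℂ) ^ i - 1) * ξ ^ i)‖ := norm_sum_le _ _
    _ ≤ ∑ i ∈ Finset.range N, √T * (N * (1 - r)) := by
      refine Finset.sum_le_sum fun i hi => ?_
      rw [norm_mul, norm_mul, norm_pow, hξ, one_pow, mul_one]
      have hn : ‖(r : ℂ) ^ i - 1‖ ≤ N * (1 - r) := by
        have h1 : (r : ℂ) ^ i - 1 = ((r ^ i - 1 : ℝ) : ℂ) := by push_cast; ring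
        have h2 : r ^ i ≤ 1 := pow_le_one₀ hr0.le hr1.le
        rw [h1, Complex.norm_real, Real.norm_eq_abs, abs_sub_comm, abs_of_nonneg (by linarith)]
        have h3 := one_add_mul_le_pow (show (-2:ℝ) ≤ r - 1 by linarith) i
        have h4 : (i : ℝ) ≤ N := by exact_mod_cast (Finset.mem_range.1 hi).le
        have h5 : 1 + (r - 1) = r := by ring
        rw [h5] at h3
        nlinarith
      exact mul_le_mul (hco i) hn (norm_nonneg _) (Real.sqrt_nonneg _)
    _ = _ := by rw [Finset.sum_const, Finset.card_range, nsmul_eq_mul]; ring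

theorem simple_case {n : ℕ} {ξ : Fin n → ℂ} {m : Fin n → ℕ} (hξ : ∀ j, ‖ξ j‖ = 1)
    (hinj : Function.Injective ξ) {k l : Fin n} (hmk : m k = 1) (hml : m l = 1) {φ : ℂ → ℂ}
    (hmap : ∀ z ∈ unitDisk, φ z ∈ unitDisk) (hlim : NTLimit φ (ξ k) (ξ l))
    (hcomp : CompBddHb ξ m φ) :
    ∃ C : ℝ, ∀ᶠ r : ℝ in nhdsWithin 1 (Iio 1), ‖φ (r * ξ k) - ξ l‖ ≤ C * (1 - r) := by
  obtain ⟨hmem, C, hC⟩ := hcomp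
  obtain ⟨A, hA0, hA⟩ := a1fun_upper ξ m hξ k
  obtain ⟨c₂, hc₂, hlow2⟩ := a1fun_lower ξ m hinj l
  have hη := hξ l
  set η := ξ l with hηdef
  have hrad := radial_phi (hξ k) hlim
  set N := ∑ j, m j with hN
  set D := A + (N : ℝ) ^ 2 with hD
  have hD0 : 0 ≤ D := by positivity
  refine ⟨2 * (D ^ 2 * |C|) / c₂ ^ 2, ?_⟩
  filter_upwards [hrad.eventually hlow2, evIoo] with r hl2 hr
  have h1r : 0 < 1 - r := by linarith [hr.2]
  obtain ⟨e1, e2, e3⟩ := radial_norms (hξ k) hr.1 hr.2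
  have hwD := hmap _ e2
  have hw := mem_unitDisk_iff.1 hwD
  set w := φ (r * ξ k) with hwdef
  rw [hml, pow_one] at hl2
  have hBpos : 0 < 1 - ‖w‖ ^ 2 := by nlinarith [norm_nonneg w]
  set T := |C| * (1 - ‖w‖ ^ 2)⁻¹ with hT
  have hT0 : 0 ≤ T := by positivity
  have hdec : HbDecompOf ξ m (fun z => a1fun ξ m z * szego w z) (szego w) 0 :=
    ⟨⟨szego_diff hwD, (szego_hasSum hwD).summable⟩,
      by simp only [Polynomial.degree_zero]; exact WithBot.bot_lt_coe _, by simp⟩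
  have hz : h2NormSq (fun z => (0 : Polynomial ℂ).eval z) = 0 := by
    unfold h2NormSq
    simp only [taylorCoeff_poly]; simp
  have hnorm : hbNormSq ξ m (fun z => a1fun ξ m z * szego w z) = (1 - ‖w‖ ^ 2)⁻¹ := by
    rw [hbNormSq_eq hξ hinj hdec, hz, add_zero]
    exact (szego_hasSum hwD).tsum_eq
  have hmemf : MemHb ξ m (fun z => a1fun ξ m z * szego w z) := ⟨(szego w, 0), hdec⟩
  have hCf := hC _ hmemf
  obtain ⟨⟨g, q⟩, hgq⟩ := hmem _ hmemf
  simp only at hgq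
  rw [hbNormSq_eq hξ hinj hgq, hnorm] at hCf
  obtain ⟨hg, hqdeg, heq⟩ := hgq
  simp only at heq
  have hle : h2NormSq g + h2NormSq (fun z => q.eval z) ≤ T :=
    hCf.trans (by rw [hT]; gcongr; exact le_abs_self C)
  have hgT : h2NormSq g ≤ T := by
    linarith [h2NormSq_nonneg (fun z => q.eval z)]
  have hqT : h2NormSq (fun z => q.eval z) ≤ T := by linarith [h2NormSq_nonneg g]
  have hq0 : q.eval (ξ k) = 0 := by
    have t1 := (a1g_tendsto ξ m hξ k (by omega) hg).add (poly_radial_tendsto q (ξ k))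
    rw [zero_add] at t1
    have hc : ContinuousAt (fun z => a1fun ξ m z * szego w z) η := by
      have hne : 1 - (starRingEnd ℂ) w * η ≠ 0 := by
        intro h0
        have h1 : (starRingEnd ℂ) w * η = 1 := by linear_combination -h0
        have h2 : ‖w‖ * ‖η‖ = 1 := by simpa using congrArg norm h1
        rw [hη] at h2; linarith
      unfold a1fun szego
      fun_prop (disch := assumption)
    have t2 := hc.tendsto.comp hrad
    have h0 : a1fun ξ m η * szego w η = 0 := by
      rw [a1fun_split ξ m l, hml, ← hηdef]; simp
    rw [h0] at t2
    refine tendsto_nhds_unique (t1.congr' ?_) t2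
    filter_upwards [evIoo] with r' hr'
    exact (heq _ (radial_norms (hξ k) hr'.1 hr'.2).2.1).symm
  have hqb := poly_diff_bound hqdeg (hξ k) hq0 hr.1 hr.2 hT0 hqT
  have b := a1g_bound ξ m (hξ k) hA hg hr.1 hr.2
  rw [hmk] at b
  set σ := √(1 - r) with hσ
  have hσ2 : σ ^ 2 = 1 - r := Real.sq_sqrt h1r.le
  have hσ0 : 0 ≤ σ := Real.sqrt_nonneg _
  have hYb : ‖a1fun ξ m (r * ξ k) * g (r * ξ k)‖ ≤ A * σ * √T := by
    apply le_of_sq_le_sq _ (by positivity)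
    rw [mul_pow, mul_pow, Real.sq_sqrt hT0, hσ2]
    apply le_of_mul_le_mul_right _ h1r
    refine b.trans ?_
    calc A ^ 2 * h2NormSq g * (1 - r) ^ (2 * 1) ≤ A ^ 2 * T * (1 - r) ^ (2 * 1) := by gcongr
      _ = _ := by ring
  have hσle : 1 - r ≤ σ := by
    rw [← hσ2]
    have : σ ≤ 1 := by rw [hσ]; exact Real.sqrt_le_one.2 (by linarith [hr.1])
    nlinarith
  have hqb2 : ‖q.eval ((r : ℂ) * ξ k)‖ ≤ (N : ℝ) ^ 2 * σ * √T := by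
    refine hqb.trans ?_
    gcongr
  have hszw : ‖szego w w‖ = (1 - ‖w‖ ^ 2)⁻¹ := by
    have : 1 - (starRingEnd ℂ) w * w = ((1 - ‖w‖ ^ 2 : ℝ) : ℂ) := by
      rw [mul_comm, Complex.mul_conj, Complex.normSq_eq_norm_sq]; push_cast; ring
    unfold szego
    rw [this, norm_inv, Complex.norm_real, Real.norm_of_nonneg hBpos.le]
  have hX : ‖a1fun ξ m w‖ * (1 - ‖w‖ ^ 2)⁻¹ ≤ D * σ * √T := by
    rw [← hszw, ← norm_mul, heq _ e2]
    refine (norm_add_le _ _).trans ?_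
    rw [hD]; linarith
  have hX2 := pow_le_pow_left₀ (by positivity) hX 2
  have hX3 : ‖a1fun ξ m w‖ ^ 2 ≤ D ^ 2 * |C| * (1 - r) * (1 - ‖w‖ ^ 2) := by
    have e5 : (D * σ * √T) ^ 2 = D ^ 2 * (1 - r) * (|C| * (1 - ‖w‖ ^ 2)⁻¹) := by
      rw [mul_pow, mul_pow, Real.sq_sqrt hT0, hσ2]
    rw [e5] at hX2
    have h6 := mul_le_mul_of_nonneg_right hX2 (sq_nonneg (1 - ‖w‖ ^ 2))
    have h7 : (‖a1fun ξ m w‖ * (1 - ‖w‖ ^ 2)⁻¹) ^ 2 * (1 - ‖w‖ ^ 2) ^ 2 = ‖a1fun ξ m w‖ ^ 2 := by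
      field_simp
    have h8 : D ^ 2 * (1 - r) * (|C| * (1 - ‖w‖ ^ 2)⁻¹) * (1 - ‖w‖ ^ 2) ^ 2
        = D ^ 2 * |C| * (1 - r) * (1 - ‖w‖ ^ 2) := by
      field_simp
    rwa [h7, h8] at h6
  have hdist : 1 - ‖w‖ ≤ ‖w - η‖ := by
    have := norm_sub_norm_le η w
    rwa [hη, norm_sub_rev] at this
  have hdpos : 0 < ‖w - η‖ := by linarith
  have h9 : 1 - ‖w‖ ^ 2 ≤ 2 * ‖w - η‖ := by nlinarith [norm_nonneg w]
  have h10 : (c₂ * ‖w - η‖) ^ 2 ≤ D ^ 2 * |C| * (1 - r) * (2 * ‖w - η‖) := by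
    refine (pow_le_pow_left₀ (by positivity) hl2 2).trans (hX3.trans ?_)
    gcongr
  rw [div_mul_eq_mul_div, le_div_iff₀ (by positivity)]
  apply le_of_mul_le_mul_right _ hdpos
  calc _ = (c₂ * ‖w - η‖) ^ 2 := by ring
    _ ≤ _ := h10
    _ = _ := by ring


/-- Corollary 4.6. If `C_φ` is bounded on `H(b)` and
`φ(ξ_k) = ξ_{ℓ_k}` for `k < p`, then `m_k ≤ m_{ℓ_k}`; and if `m_k = m_{ℓ_k}` for some
`k < p`, then `φ` has an angular derivative in the sense of Carathéodory at `ξ_k`. -/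
theorem multiplicities_and_ADC
    (b a : ℂ → ℂ) (n : ℕ) (ξ : Fin n → ℂ) (m : Fin n → ℕ)
    (hset : RationalSetting b a n ξ m)
    (φ : ℂ → ℂ) (hφb : MemHb ξ m φ) (hφball : MemBallHinf φ)
    (hφmap : ∀ z ∈ unitDisk, φ z ∈ unitDisk)
    (Λ : Fin n → ℂ) (hΛ : ∀ j, NTLimit φ (ξ j) (Λ j))
    (p : ℕ) (hp : p ≤ n)
    (hΛcirc : ∀ j : Fin n, (j : ℕ) < p → ∃ i, Λ j = ξ i)
    (hΛdisk : ∀ j : Fin n, p ≤ (j : ℕ) → Λ j ∈ unitDisk)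
    (l : Fin n → Fin n) (hl : ∀ k : Fin n, (k : ℕ) < p → Λ k = ξ (l k))
    (hbdd : CompBddHb ξ m φ) :
    (∀ k : Fin n, (k : ℕ) < p → m k ≤ m (l k)) ∧
    (∀ k : Fin n, (k : ℕ) < p → m k = m (l k) → HasADC φ (ξ k)) := by
  have hξ : ∀ j, ‖ξ j‖ = 1 := fun j => by
    have := hset.zeros_mem j
    simpa [unitCircle] using this
  have hinj := hset.zeros_inj
  have hlim : ∀ k : Fin n, (k : ℕ) < p → NTLimit φ (ξ k) (ξ (l k)) := fun k hk => by
    rw [← hl k hk]; exact hΛ k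
  refine ⟨fun k hk => mult_le hξ hinj hset.mult_pos hφb hφball.1 hφmap (hlim k hk) hbdd.1,
    fun k hk hm => ?_⟩
  apply hasADC_of_radial hφball.1 hφmap (hξ k) (hξ (l k)) (hlim k hk)
  have hpos := hset.mult_pos k
  by_cases h2 : 2 ≤ m k
  · obtain ⟨C, -, hC⟩ := linear_bound hξ h2 hφb (hlim k hk)
    exact ⟨C, hC⟩
  · have h1 : m k = 1 := by omega
    exact simple_case hξ hinj h1 (hm ▸ h1) hφmap (hlim k hk) hbdd

end
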